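/- arXiv:1102.0267 — 9 statements merged into one kernel-verified Lean document; each statement's English description precedes it below -/
import Mathlib

section
/- Let M and N be positive integers, H ∈ ℂ^{N×M}, and ρ ≥ 0 a real number. Then the (real, positive) determinant of I_N + (ρ/M)·H·(I_M + ρ·H†·H)⁻¹·H† satisfies det(I_N + (ρ/M)·H·(I_M + ρ·H†·H)⁻¹·H†) ≤ ((M+1)/M)^{min(M,N)}. -/
open Matrix ComplexOrder

/-- The determinant of `1 + t • A` as a product over the eigenvalues of the Hermitian matrix `A`. -/
theorem Matrix.IsHermitian.det_one_add_smul {n : Type*} [Fintype n] [DecidableEq n]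
    {A : Matrix n n ℂ} (hA : A.IsHermitian) (t : ℝ) :
    (1 + (t : ℂ) • A).det = ((∏ i, (1 + t * hA.eigenvalues i) : ℝ) : ℂ) := by
  set U := (hA.eigenvectorUnitary : Matrix n n ℂ)
  have hU : U * star U = 1 := Unitary.coe_mul_star_self hA.eigenvectorUnitary
  set D : Matrix n n ℂ := diagonal fun i => (hA.eigenvalues i : ℂ) with hD
  have h1 : A = U * D * star U := hA.spectral_theorem
  have h2 : 1 + (t : ℂ) • A = U * (1 + (t : ℂ) • D) * star U := by
    rw [Matrix.mul_add, Matrix.add_mul, Matrix.mul_one, hU, Matrix.mul_smul, Matrix.smul_mul, ← h1]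
  have h3 : (1 + (t : ℂ) • D) = diagonal fun i => 1 + (t : ℂ) * hA.eigenvalues i := by
    rw [hD, ← diagonal_one, ← diagonal_smul, diagonal_add]
    rfl
  rw [h2, det_mul_right_comm, hU, Matrix.one_mul, h3, det_diagonal]
  push_cast
  rfl

/-- For `A` positive semidefinite, scaling `ρ` by `1 + c` increases `det (1 + ρ • A)` by a factor
at most `(1 + c) ^ card n`. -/
theorem Matrix.PosSemidef.det_ratio_le {n : Type*} [Fintype n] [DecidableEq n]
    {A : Matrix n n ℂ} (hA : A.PosSemidef) {ρ c : ℝ} (hρ : 0 ≤ ρ) (hc : 0 ≤ c) :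
    ((1 + (((1 + c) * ρ : ℝ) : ℂ) • A).det / (1 + (ρ : ℂ) • A).det).re
      ≤ (1 + c) ^ Fintype.card n := by
  rw [hA.isHermitian.det_one_add_smul, hA.isHermitian.det_one_add_smul, ← Complex.ofReal_div,
    Complex.ofReal_re]
  have hev := hA.eigenvalues_nonneg
  rw [← Finset.prod_div_distrib, ← Finset.card_univ, ← Finset.prod_const]
  refine Finset.prod_le_prod (fun i _ => ?_) fun i _ => ?_
  · have := hev i
    positivity
  · have h : 0 ≤ ρ * hA.isHermitian.eigenvalues i := mul_nonneg hρ (hev i)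
    rw [div_le_iff₀ (by linarith)]
    nlinarith

theorem Matrix.PosSemidef.isUnit_det_one_add_smul {n : Type*} [Fintype n] [DecidableEq n]
    {A : Matrix n n ℂ} (hA : A.PosSemidef) {ρ : ℝ} (hρ : 0 ≤ ρ) :
    IsUnit (1 + (ρ : ℂ) • A).det := by
  rw [hA.isHermitian.det_one_add_smul, isUnit_iff_ne_zero, Complex.ofReal_ne_zero]
  refine Finset.prod_ne_zero_iff.mpr fun i _ => ?_
  have h : 0 ≤ ρ * hA.isHermitian.eigenvalues i := mul_nonneg hρ (hA.eigenvalues_nonneg i)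
  linarith

theorem Matrix.det_one_add_smul_conjTranspose_mul_self {m n : Type*} [Fintype m] [Fintype n]
    [DecidableEq m] [DecidableEq n] (H : Matrix n m ℂ) (t : ℂ) :
    (1 + t • (Hᴴ * H)).det = (1 + t • (H * Hᴴ)).det := by
  rw [← Matrix.smul_mul, det_one_add_mul_comm, Matrix.mul_smul]

theorem Matrix.det_one_add_smul_mul_inv_mul {m n : Type*} [Fintype m] [Fintype n]
    [DecidableEq m] [DecidableEq n] (H : Matrix n m ℂ) {ρ : ℝ} (hρ : 0 ≤ ρ) (c : ℝ) :
    (1 + ((c * ρ : ℝ) : ℂ) • (H * (1 + (ρ : ℂ) • (Hᴴ * H))⁻¹ * Hᴴ)).det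
      = (1 + (((1 + c) * ρ : ℝ) : ℂ) • (Hᴴ * H)).det / (1 + (ρ : ℂ) • (Hᴴ * H)).det := by
  have hu := (posSemidef_conjTranspose_mul_self H).isUnit_det_one_add_smul hρ
  rw [eq_div_iff hu.ne_zero, Matrix.mul_assoc, ← Matrix.smul_mul, det_one_add_mul_comm,
    Matrix.mul_smul, Matrix.mul_assoc, ← Matrix.mul_smul, det_one_add_mul_comm, ← det_mul,
    Matrix.add_mul, Matrix.one_mul, Matrix.mul_assoc, nonsing_inv_mul _ hu, Matrix.mul_one]
  congr 1
  push_cast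
  module

/-- For `H ∈ ℂ^{N×M}` and `ρ ≥ 0`, the (real, positive) determinant of
`I_N + (ρ/M)·H·(I_M + ρ·H†·H)⁻¹·H†` is at most `((M+1)/M)^{min(M,N)}`. -/
theorem stmt_4 (M N : ℕ) (hM : 0 < M) (hN : 0 < N)
    (H : Matrix (Fin N) (Fin M) ℂ) (ρ : ℝ) (hρ : 0 ≤ ρ) :
    (((1 : Matrix (Fin N) (Fin N) ℂ)
        + ((ρ / M : ℝ) : ℂ) • (H * (1 + (ρ : ℂ) • (Hᴴ * H))⁻¹ * Hᴴ)).det).re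
      ≤ (((M : ℝ) + 1) / M) ^ (min M N) := by
  have hc : (0 : ℝ) ≤ 1 / M := by positivity
  have hM' : (M : ℝ) ≠ 0 := by positivity
  rw [show ρ / M = 1 / M * ρ by ring, show ((M : ℝ) + 1) / M = 1 + 1 / M by field_simp,
    det_one_add_smul_mul_inv_mul H hρ]
  rcases min_choice M N with h | h <;> rw [h]
  · simpa only [Fintype.card_fin] using
      (posSemidef_conjTranspose_mul_self H).det_ratio_le hρ hc
  · rw [det_one_add_smul_conjTranspose_mul_self, det_one_add_smul_conjTranspose_mul_self]
    simpa only [Fintype.card_fin] using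
      (posSemidef_self_mul_conjTranspose H).det_ratio_le hρ hc
end

section
/- Let n be a positive integer, A an n×n complex Hermitian positive semidefinite matrix, m a natural number with rank(A) ≤ m, and M ≥ 1 a real number. Then the (real, positive) determinants satisfy det((1/M)·A + I_n) ≥ det(A + I_n) / M^m. -/
open Matrix ComplexOrder

/-- The determinant of `c • A + 1` for Hermitian `A`, in terms of the eigenvalues of `A`. -/
lemma Matrix.IsHermitian.det_smul_add_one {ι : Type*} [Fintype ι] [DecidableEq ι]
    {A : Matrix ι ι ℂ} (hA : A.IsHermitian) (c : ℝ) :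
    ((c : ℂ) • A + 1).det = ((∏ i, (c * hA.eigenvalues i + 1) : ℝ) : ℂ) := by
  have h : (c : ℂ) • A + 1 = Unitary.conjStarAlgAut ℂ _ hA.eigenvectorUnitary
      (diagonal fun i => ((c * hA.eigenvalues i + 1 : ℝ) : ℂ)) := by
    conv_lhs => rw [hA.spectral_theorem]
    rw [← map_smul, ← map_one (Unitary.conjStarAlgAut ℂ _ hA.eigenvectorUnitary), ← map_add]
    congr 1
    ext i j
    by_cases hij : i = j <;> simp [hij]
  rw [h, Unitary.conjStarAlgAut_apply, det_mul_comm, ← mul_assoc]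
  simp

/-- Dividing the nonzero eigenvalues by `M` costs at most a factor `M` each. -/
lemma prod_add_one_le_pow_mul_prod {ι : Type*} [Fintype ι] (f : ι → ℝ) (hf : ∀ i, 0 ≤ f i)
    {M : ℝ} (hM : 1 ≤ M) :
    ∏ i, (f i + 1) ≤ M ^ Fintype.card {i // f i ≠ 0} * ∏ i, (1 / M * f i + 1) := by
  classical
  have hM0 : 0 < M := by linarith
  have hpow : M ^ Fintype.card {i // f i ≠ 0} = ∏ i, if f i ≠ 0 then M else 1 := by
    rw [Fintype.card_subtype, Finset.prod_ite, Finset.prod_const, Finset.prod_const_one, mul_one]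
  rw [hpow, ← Finset.prod_mul_distrib]
  refine Finset.prod_le_prod (fun i _ => by linarith [hf i]) fun i _ => ?_
  split_ifs with h
  · have : M * (1 / M * f i + 1) = f i + M := by field_simp
    linarith
  · simp [not_not.mp h]

/-- If `A` is an `n × n` complex Hermitian positive semidefinite matrix
with `rank A ≤ m` and `M ≥ 1` is real, then
`det ((1/M)·A + I_n) ≥ det (A + I_n) / M^m` (determinants are positive reals). -/
theorem stmt_5 (n : ℕ) (hn : 0 < n) (A : Matrix (Fin n) (Fin n) ℂ)
    (hA : A.PosSemidef) (m : ℕ) (hrank : A.rank ≤ m) (M : ℝ) (hM : 1 ≤ M) :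
    ((A + 1).det).re / M ^ m ≤ ((((1 / M : ℝ) : ℂ) • A + 1).det).re := by
  have hM0 : 0 < M := by linarith
  have h1 : (A + 1).det = ((∏ i, (hA.isHermitian.eigenvalues i + 1) : ℝ) : ℂ) := by
    simpa using hA.isHermitian.det_smul_add_one 1
  rw [h1, hA.isHermitian.det_smul_add_one, Complex.ofReal_re, Complex.ofReal_re,
    div_le_iff₀' (pow_pos hM0 m)]
  refine (prod_add_one_le_pow_mul_prod _ hA.eigenvalues_nonneg hM).trans ?_
  rw [← hA.isHermitian.rank_eq_card_non_zero_eigs]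
  refine mul_le_mul_of_nonneg_right (pow_le_pow_right₀ hM hrank) (Finset.prod_nonneg fun i _ => ?_)
  have := hA.eigenvalues_nonneg i
  positivity
end

section
/- Let M1, M2, N1 be positive integers, H11 ∈ ℂ^{N1×M1}, H12 ∈ ℂ^{N2×M1}, H21 ∈ ℂ^{N1×M2}, and ρ11, ρ12, ρ21 ≥ 0 real. Let Q1 be an M1×M1 Hermitian positive semidefinite matrix with Q1 ⪯ I_{M1} and Hermitian positive semidefinite square root Q1^{1/2}, and let Q2 be an M2×M2 Hermitian positive semidefinite matrix with Q2 ⪯ I_{M2}. Then det(I_{N1} + ρ21·H21·Q2·H21† + ρ11·H11·Q1^{1/2}·(I_{M1} + ρ12·Q1^{1/2}·H12†·H12·Q1^{1/2})⁻¹·Q1^{1/2}·H11†) ≤ det(I_{N1} + ρ21·H21·H21† + ρ11·H11·(I_{M1} + ρ12·H12†·H12)⁻¹·H11†), where both determinants are positive real numbers. -/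
open Matrix ComplexOrder

theorem inv_one_add_sub_conj_inv_eq {α : Type*} [Ring α] {S G T X : α}
    (hT1 : T * (1 + G) = 1) (hT2 : (1 + G) * T = 1)
    (hX1 : X * (1 + S * G * S) = 1) (hX2 : (1 + S * G * S) * X = 1) :
    T - S * X * S = T * (1 - S * S) * T + ((T - S * X * S) * G * (T - S * X * S)
      + (T - S * X * S) * (G * (S * S) * G) * (T - S * X * S)) := by
  have hTG : T * G = 1 - T := by rw [← hT1]; noncomm_ring
  have hGT : G * T = 1 - T := by rw [← hT2]; noncomm_ring
  have hRGQ : S * X * S * G * (S * S) = S * S - S * X * S := by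
    have h : S * (X * (1 + S * G * S)) * S = S * S := by rw [hX1, mul_one]
    rw [eq_sub_iff_add_eq]
    refine Eq.trans ?_ h
    noncomm_ring
  have hQGR : S * S * (G * (S * X * S)) = S * S - S * X * S := by
    have h : S * ((1 + S * G * S) * X) * S = S * S := by rw [hX2, mul_one]
    rw [eq_sub_iff_add_eq]
    refine Eq.trans ?_ h
    noncomm_ring
  generalize S * X * S = R at *
  generalize S * S = Q at *
  have hDG : (T - R) * G = 1 - T - R * G := by rw [sub_mul, hTG]
  have hGD : G * (T - R) = 1 - T - G * R := by rw [mul_sub, hGT]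
  have hDGQ : (T - R) * G * Q = R - T * Q := by
    rw [hDG, sub_mul, sub_mul, hRGQ]; noncomm_ring
  have h1 : (T - R) * G * (T - R) = T - T * T - R - (R - R * T) + T * R + R * G * R := by
    rw [hDG]
    have : R * G * T = R - R * T := by rw [mul_assoc, hGT]; noncomm_ring
    rw [mul_sub, sub_mul _ _ T, this]; noncomm_ring
  have h2 : (T - R) * (G * Q * G) * (T - R)
      = R - R * T - R * G * R - T * Q + T * Q * T + T * (Q - R) := by
    have : (T - R) * (G * Q * G) * (T - R) = (T - R) * G * Q * (G * (T - R)) := by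
      simp only [mul_assoc]
    rw [this, hDGQ, hGD, ← hQGR]; noncomm_ring
  rw [h1, h2]; noncomm_ring

namespace Matrix

variable {n 𝕜 : Type*} [Fintype n] [DecidableEq n] [RCLike 𝕜]

theorem PosSemidef.one_le_det_one_add {P : Matrix n n 𝕜} (hP : P.PosSemidef) :
    1 ≤ (1 + P).det := by
  have h : (1 + P).det = ((∏ i, (1 + hP.1.eigenvalues i) : ℝ) : 𝕜) := by
    have key := congrArg (Polynomial.eval (-1)) hP.1.charpoly_eq
    rw [Matrix.eval_charpoly] at key
    have e : scalar n (-1 : 𝕜) - P = -(1 + P) := by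
      rw [map_neg, map_one]; abel
    rw [e, det_neg, Polynomial.eval_prod] at key
    have e2 : ∀ i, Polynomial.eval (-1 : 𝕜) (Polynomial.X -
        Polynomial.C (hP.1.eigenvalues i : 𝕜)) = -1 * (1 + (hP.1.eigenvalues i : 𝕜)) := by
      intro i; simp; ring
    simp only [e2, Finset.prod_mul_distrib, Finset.prod_const, Finset.card_univ] at key
    push_cast
    exact mul_left_cancel₀ (pow_ne_zero _ (by simp)) key
  rw [h, ← RCLike.ofReal_one, RCLike.ofReal_le_ofReal]
  exact Finset.one_le_prod fun i _ => by linarith [hP.eigenvalues_nonneg i]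

open scoped MatrixOrder in
theorem PosDef.det_le_det_add {A B : Matrix n n 𝕜} (hA : A.PosDef) (hB : B.PosSemidef) :
    A.det ≤ (A + B).det := by
  obtain ⟨U, rfl⟩ := CStarAlgebra.nonneg_iff_eq_star_mul_self.mp hB.nonneg
  rw [star_eq_conjTranspose]
  rw [det_add_mul _ _ ((isUnit_iff_isUnit_det A).mp hA.isUnit)]
  have h := (hA.inv.posSemidef.mul_mul_conjTranspose_same U).one_le_det_one_add
  exact le_mul_of_one_le_right hA.det_pos.le h

/-- If `S * S ≤ 1` then `S (1 + S G S)⁻¹ S ≤ (1 + G)⁻¹`. -/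
theorem PosSemidef.inv_one_add_sub_conj_inv {S G : Matrix n n 𝕜} (hS : S.IsHermitian)
    (hS1 : (1 - S * S).PosSemidef) (hG : G.PosSemidef) :
    ((1 + G)⁻¹ - S * (1 + S * G * S)⁻¹ * S).PosSemidef := by
  have hSGS : (S * G * S).PosSemidef := by
    simpa only [hS.eq] using hG.mul_mul_conjTranspose_same S
  have hY : (1 + G).PosDef := PosDef.one.add_posSemidef hG
  have hZ : (1 + S * G * S).PosDef := PosDef.one.add_posSemidef hSGS
  have hYu := (isUnit_iff_isUnit_det _).mp hY.isUnit
  have hZu := (isUnit_iff_isUnit_det _).mp hZ.isUnit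
  have hT : ((1 + G)⁻¹)ᴴ = (1 + G)⁻¹ := hY.inv.1
  have hD : ((1 + G)⁻¹ - S * (1 + S * G * S)⁻¹ * S)ᴴ
      = (1 + G)⁻¹ - S * (1 + S * G * S)⁻¹ * S := by
    rw [conjTranspose_sub, hT, conjTranspose_mul, conjTranspose_mul, hS.eq, hZ.inv.1.eq,
      ← Matrix.mul_assoc]
  have hGQG : (G * (S * S) * G).PosSemidef := by
    have h := posSemidef_self_mul_conjTranspose (G * S)
    rwa [conjTranspose_mul, hS.eq, hG.1.eq, Matrix.mul_assoc, ← Matrix.mul_assoc S S G,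
      ← Matrix.mul_assoc] at h
  rw [inv_one_add_sub_conj_inv_eq (nonsing_inv_mul _ hYu) (mul_nonsing_inv _ hYu)
    (nonsing_inv_mul _ hZu) (mul_nonsing_inv _ hZu)]
  have h0 := hS1.mul_mul_conjTranspose_same (1 + G)⁻¹
  have h1 := hG.mul_mul_conjTranspose_same ((1 + G)⁻¹ - S * (1 + S * G * S)⁻¹ * S)
  have h2 := hGQG.mul_mul_conjTranspose_same ((1 + G)⁻¹ - S * (1 + S * G * S)⁻¹ * S)
  rw [hT] at h0
  rw [hD] at h1 h2
  exact h0.add (h1.add h2)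

end Matrix

/-- With `Q1 ⪯ I_{M1}` (with p.s.d. square root `Q1h`) and `Q2 ⪯ I_{M2}`
Hermitian positive semidefinite, the determinant
`det(I_{N1} + ρ21·H21·Q2·H21† + ρ11·H11·Q1h·(I_{M1} + ρ12·Q1h·H12†·H12·Q1h)⁻¹·Q1h·H11†)`
is at most
`det(I_{N1} + ρ21·H21·H21† + ρ11·H11·(I_{M1} + ρ12·H12†·H12)⁻¹·H11†)`
(both determinants are positive reals). -/
theorem stmt_7 (M1 M2 N1 N2 : ℕ) (hM1 : 0 < M1) (hM2 : 0 < M2) (hN1 : 0 < N1)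
    (H11 : Matrix (Fin N1) (Fin M1) ℂ) (H12 : Matrix (Fin N2) (Fin M1) ℂ)
    (H21 : Matrix (Fin N1) (Fin M2) ℂ)
    (ρ11 ρ12 ρ21 : ℝ) (h11 : 0 ≤ ρ11) (h12 : 0 ≤ ρ12) (h21 : 0 ≤ ρ21)
    (Q1 Q1h : Matrix (Fin M1) (Fin M1) ℂ) (hQ1 : Q1.PosSemidef)
    (hQ1le : ((1 : Matrix (Fin M1) (Fin M1) ℂ) - Q1).PosSemidef)
    (hQ1h : Q1h.PosSemidef) (hQ1sq : Q1h * Q1h = Q1)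
    (Q2 : Matrix (Fin M2) (Fin M2) ℂ) (hQ2 : Q2.PosSemidef)
    (hQ2le : ((1 : Matrix (Fin M2) (Fin M2) ℂ) - Q2).PosSemidef) :
    ((1 + (ρ21 : ℂ) • (H21 * Q2 * H21ᴴ)
        + (ρ11 : ℂ) • (H11 * Q1h * (1 + (ρ12 : ℂ) • (Q1h * H12ᴴ * H12 * Q1h))⁻¹
            * Q1h * H11ᴴ)).det).re
      ≤ ((1 + (ρ21 : ℂ) • (H21 * H21ᴴ)
        + (ρ11 : ℂ) • (H11 * (1 + (ρ12 : ℂ) • (H12ᴴ * H12))⁻¹ * H11ᴴ)).det).re := by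
  set G : Matrix (Fin M1) (Fin M1) ℂ := (ρ12 : ℂ) • (H12ᴴ * H12) with hG
  have c11 : (0 : ℂ) ≤ (ρ11 : ℂ) := Complex.zero_le_real.mpr h11
  have c12 : (0 : ℂ) ≤ (ρ12 : ℂ) := Complex.zero_le_real.mpr h12
  have c21 : (0 : ℂ) ≤ (ρ21 : ℂ) := Complex.zero_le_real.mpr h21
  have hGp : G.PosSemidef := (posSemidef_conjTranspose_mul_self H12).smul c12
  have hSG : (ρ12 : ℂ) • (Q1h * H12ᴴ * H12 * Q1h) = Q1h * G * Q1h := by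
    simp only [hG, Matrix.mul_smul, Matrix.smul_mul, Matrix.mul_assoc]
  rw [hSG]
  set R := Q1h * (1 + Q1h * G * Q1h)⁻¹ * Q1h with hR
  have hHR : H11 * Q1h * (1 + Q1h * G * Q1h)⁻¹ * Q1h * H11ᴴ = H11 * R * H11ᴴ := by
    simp only [hR, Matrix.mul_assoc]
  rw [hHR]
  have hRp : R.PosSemidef := by
    have hSGS := hGp.mul_mul_conjTranspose_same Q1h
    rw [hQ1h.1.eq] at hSGS
    have h := (PosDef.one.add_posSemidef hSGS).inv.posSemidef.mul_mul_conjTranspose_same Q1h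
    rwa [hQ1h.1.eq] at h
  have hTR : ((1 + G)⁻¹ - R).PosSemidef :=
    PosSemidef.inv_one_add_sub_conj_inv hQ1h.1 (hQ1sq ▸ hQ1le) hGp
  have hA : (1 + (ρ21 : ℂ) • (H21 * Q2 * H21ᴴ) + (ρ11 : ℂ) • (H11 * R * H11ᴴ)).PosDef :=
    (PosDef.one.add_posSemidef ((hQ2.mul_mul_conjTranspose_same H21).smul c21)).add_posSemidef
      ((hRp.mul_mul_conjTranspose_same H11).smul c11)
  have hB := ((hQ2le.mul_mul_conjTranspose_same H21).smul c21).add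
    ((hTR.mul_mul_conjTranspose_same H11).smul c11)
  have h := hA.det_le_det_add hB
  have e : 1 + (ρ21 : ℂ) • (H21 * Q2 * H21ᴴ) + (ρ11 : ℂ) • (H11 * R * H11ᴴ)
      + ((ρ21 : ℂ) • (H21 * (1 - Q2) * H21ᴴ) + (ρ11 : ℂ) • (H11 * ((1 + G)⁻¹ - R) * H11ᴴ))
      = 1 + (ρ21 : ℂ) • (H21 * H21ᴴ) + (ρ11 : ℂ) • (H11 * (1 + G)⁻¹ * H11ᴴ) := by
    simp only [Matrix.mul_sub, Matrix.sub_mul, Matrix.mul_one, smul_sub]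
    abel
  rw [e] at h
  exact (Complex.le_def.mp h).1
end

section
/- With the channel setup below, the following determinant inequality holds: det(I_{N1} + ρ11·H11·K1u·H11† + ρ21·H21·K2u·H21†) ≥ det(I_{N1} + ρ11·H11·K1·H11†) · det(I_{N1} + ρ21·H21·K2u·H21†) / ( M1^{min(M1,N1)} · ((M2+1)/M2)^{min(M2,N1)} ), where all determinants are positive real numbers. -/
open Matrix ComplexOrder

/-- `KK H ρ = (I + ρ·H†·H)⁻¹`. -/
noncomputable def KK {m n : ℕ} (H : Matrix (Fin n) (Fin m) ℂ) (ρ : ℝ) :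
    Matrix (Fin m) (Fin m) ℂ :=
  (1 + (ρ : ℂ) • (Hᴴ * H))⁻¹

/-- `Ku H ρ = (1/m)·(I + ρ·H†·H)⁻¹` where `m` is the column dimension. -/
noncomputable def Ku {m n : ℕ} (H : Matrix (Fin n) (Fin m) ℂ) (ρ : ℝ) :
    Matrix (Fin m) (Fin m) ℂ :=
  ((m : ℂ))⁻¹ • KK H ρ

open scoped MatrixOrder

theorem posDef_one_add {n : Type*} [DecidableEq n] {P : Matrix n n ℂ} (hP : P.PosSemidef) :
    (1 + P).PosDef :=
  PosDef.one.add_posSemidef hP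

section DetInequalities

variable {n m : Type*} [Fintype n] [DecidableEq n] [Fintype m] [DecidableEq m]

/-- `det (1 + Q) ≥ 1` for `Q` positive semidefinite. -/
theorem one_le_det_one_add {Q : Matrix n n ℂ} (hQ : Q.PosSemidef) : 1 ≤ (1 + Q).det := by
  have hspec := hQ.1.spectral_theorem
  have h : (1 + Q).det = ∏ i, (1 + (hQ.1.eigenvalues i : ℂ)) := by
    have hd : (1 : Matrix n n ℂ) + diagonal (RCLike.ofReal ∘ hQ.1.eigenvalues) =
        diagonal fun i => 1 + (hQ.1.eigenvalues i : ℂ) := by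
      rw [← diagonal_one, diagonal_add]; rfl
    conv_lhs => rw [hspec]
    rw [← map_one (Unitary.conjStarAlgAut ℂ (Matrix n n ℂ) hQ.1.eigenvectorUnitary), ← map_add,
      hd, Unitary.conjStarAlgAut_apply, det_mul_comm, ← mul_assoc, Unitary.coe_star_mul_self,
      one_mul, det_diagonal]
  rw [h]
  have hr : ∀ i, (1 : ℝ) ≤ 1 + hQ.1.eigenvalues i := fun i => by
    linarith [hQ.eigenvalues_nonneg i]
  have hprod := Finset.one_le_prod (s := Finset.univ) fun i _ => hr i
  exact_mod_cast hprod

/-- The determinant is monotone along positive semidefinite perturbations of a positive definite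
matrix. -/
theorem det_le_det_add {P Q : Matrix n n ℂ} (hP : P.PosDef) (hQ : Q.PosSemidef) :
    P.det ≤ (P + Q).det := by
  obtain ⟨C, hC⟩ := CStarAlgebra.nonneg_iff_eq_star_mul_self.mp hP.posSemidef.nonneg
  rw [star_eq_conjTranspose] at hC
  have hCu : IsUnit C.det := by
    have := (isUnit_iff_isUnit_det _).mp hP.isUnit
    rw [hC, det_mul] at this
    exact isUnit_of_mul_isUnit_right this
  have hCu' : IsUnit Cᴴ.det := by rw [det_conjTranspose]; exact hCu.star
  have hfac : P + Q = Cᴴ * (1 + C⁻¹ᴴ * Q * C⁻¹) * C := by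
    rw [mul_add, add_mul, mul_one, ← hC, conjTranspose_nonsing_inv]
    congr 1
    rw [mul_assoc Cᴴ⁻¹, mul_nonsing_inv_cancel_left _ _ hCu', nonsing_inv_mul_cancel_right _ _ hCu]
  have hdet : (P + Q).det = P.det * (1 + C⁻¹ᴴ * Q * C⁻¹).det := by
    rw [hfac, hC]; simp only [det_mul]; ring
  rw [hdet]
  exact le_mul_of_one_le_right hP.det_pos.le
    (one_le_det_one_add (hQ.conjTranspose_mul_mul_same C⁻¹))

theorem det_one_add_smul_le {P : Matrix n n ℂ} (hP : P.PosSemidef) {d : ℝ} (hd : 1 ≤ d) :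
    (1 + (d : ℂ) • P).det ≤ (d : ℂ) ^ Fintype.card n * (1 + P).det := by
  have h : (d : ℂ) • (1 + P) = (1 + (d : ℂ) • P) + ((d - 1 : ℝ) : ℂ) • (1 : Matrix n n ℂ) := by
    push_cast
    module
  rw [← det_smul, h]
  refine det_le_det_add (posDef_one_add (hP.smul ?_)) (PosSemidef.one.smul ?_)
  · exact_mod_cast zero_le_one.trans hd
  · exact_mod_cast sub_nonneg.mpr hd

theorem det_one_add_smul_mul_conjTranspose_comm (Y : Matrix m n ℂ) (c : ℂ) :
    (1 + c • (Y * Yᴴ)).det = (1 + c • (Yᴴ * Y)).det := by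
  rw [← smul_mul, det_one_add_mul_comm, Matrix.mul_smul]

/-- Rescaling a Gram matrix by `d ≥ 1` multiplies `det (1 + ·)` by at most `d` to the power of the
smaller dimension. -/
theorem det_one_add_smul_mul_conjTranspose_le (Y : Matrix m n ℂ) {s d : ℝ} (hs : 0 ≤ s)
    (hd : 1 ≤ d) :
    (1 + (d : ℂ) • (s : ℂ) • (Y * Yᴴ)).det ≤
      (d : ℂ) ^ min (Fintype.card n) (Fintype.card m) * (1 + (s : ℂ) • (Y * Yᴴ)).det := by
  have hs' : (0 : ℂ) ≤ (s : ℂ) := by exact_mod_cast hs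
  rcases le_total (Fintype.card n) (Fintype.card m) with h | h
  · rw [min_eq_left h]
    rw [smul_smul, det_one_add_smul_mul_conjTranspose_comm,
      det_one_add_smul_mul_conjTranspose_comm, ← smul_smul]
    exact det_one_add_smul_le ((posSemidef_conjTranspose_mul_self Y).smul hs') hd
  · rw [min_eq_right h]
    exact det_one_add_smul_le ((posSemidef_self_mul_conjTranspose Y).smul hs') hd

end DetInequalities

theorem KK_posDef {m n : ℕ} (H : Matrix (Fin n) (Fin m) ℂ) {ρ : ℝ} (hρ : 0 ≤ ρ) :
    (KK H ρ).PosDef :=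
  (posDef_one_add ((posSemidef_conjTranspose_mul_self H).smul (by exact_mod_cast hρ))).inv

theorem Ku_posSemidef {m n : ℕ} (H : Matrix (Fin n) (Fin m) ℂ) {ρ : ℝ} (hρ : 0 ≤ ρ) :
    (Ku H ρ).PosSemidef :=
  (KK_posDef H hρ).posSemidef.smul (by positivity)

theorem posSemidef_smul_mul_mul_conjTranspose {m n : ℕ} (G : Matrix (Fin n) (Fin m) ℂ)
    {K : Matrix (Fin m) (Fin m) ℂ} (hK : K.PosSemidef) {ρ : ℝ} (hρ : 0 ≤ ρ) :
    ((ρ : ℂ) • (G * K * Gᴴ)).PosSemidef :=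
  (hK.mul_mul_conjTranspose_same G).smul (by exact_mod_cast hρ)

theorem det_one_add_KK_le {k m n : ℕ} (hm : 0 < m) (G : Matrix (Fin n) (Fin m) ℂ)
    (H : Matrix (Fin k) (Fin m) ℂ) {r ρ : ℝ} (hr : 0 ≤ r) (hρ : 0 ≤ ρ) :
    (1 + (r : ℂ) • (G * KK H ρ * Gᴴ)).det ≤
      (m : ℂ) ^ min m n * (1 + (r : ℂ) • (G * Ku H ρ * Gᴴ)).det := by
  obtain ⟨C, hC⟩ := CStarAlgebra.nonneg_iff_eq_star_mul_self.mp (KK_posDef H hρ).posSemidef.nonneg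
  rw [star_eq_conjTranspose] at hC
  have hm0 : (m : ℂ) ≠ 0 := by exact_mod_cast hm.ne'
  have hY : G * KK H ρ * Gᴴ = (G * Cᴴ) * (G * Cᴴ)ᴴ := by
    simp [hC, Matrix.mul_assoc]
  have h := det_one_add_smul_mul_conjTranspose_le (G * Cᴴ) (s := r / m) (d := m) (by positivity)
    (by exact_mod_cast hm)
  rw [← hY, smul_smul] at h
  have h1 : ((m : ℝ) : ℂ) * ((r / m : ℝ) : ℂ) = r := by push_cast; field_simp
  have h2 : ((r / m : ℝ) : ℂ) • (G * KK H ρ * Gᴴ) = (r : ℂ) • (G * Ku H ρ * Gᴴ) := by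
    rw [Ku, Matrix.mul_smul, smul_mul, smul_smul]
    push_cast
    rfl
  rw [h1, h2] at h
  simpa using h

theorem det_one_add_Ku_le {m n : ℕ} (hm : 0 < m) (H : Matrix (Fin n) (Fin m) ℂ) {ρ : ℝ}
    (hρ : 0 ≤ ρ) :
    (1 + (ρ : ℂ) • (H * Ku H ρ * Hᴴ)).det ≤ (((m : ℂ) + 1) / m) ^ min m n := by
  have hm0 : (m : ℂ) ≠ 0 := by exact_mod_cast hm.ne'
  have hmr : (0 : ℝ) < m := by exact_mod_cast hm
  set S := (1 : Matrix (Fin m) (Fin m) ℂ) + (ρ : ℂ) • (Hᴴ * H) with hS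
  have hSpd : S.PosDef :=
    posDef_one_add ((posSemidef_conjTranspose_mul_self H).smul (by exact_mod_cast hρ))
  have hSu : IsUnit S.det := (isUnit_iff_isUnit_det _).mp hSpd.isUnit
  have hcomm := det_one_add_smul_mul_conjTranspose_comm H
  have h := det_one_add_smul_mul_conjTranspose_le H (s := ρ) (d := (m + 1) / m) hρ
    (by rw [le_div_iff₀ hmr]; linarith)
  have hK : S * KK H ρ = 1 := mul_nonsing_inv _ hSu
  have hprod : S.det * (1 + (ρ : ℂ) • (H * Ku H ρ * Hᴴ)).det =
      (1 + (((m + 1) / m : ℝ) : ℂ) • (ρ : ℂ) • (H * Hᴴ)).det := by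
    rw [Matrix.mul_assoc H, ← Matrix.smul_mul, det_one_add_mul_comm, smul_smul, hcomm, ← det_mul]
    congr 1
    have hc : (((m + 1) / m : ℝ) : ℂ) * ρ = ρ + ρ * (m : ℂ)⁻¹ := by push_cast; field_simp
    rw [mul_add, mul_one, Ku, ← Matrix.mul_assoc, ← Matrix.mul_assoc, Matrix.mul_smul,
      Matrix.mul_smul, hK, Matrix.smul_mul, Matrix.one_mul, Matrix.smul_mul, smul_smul, hS, add_assoc,
      ← add_smul, hc]
  rw [← hprod, hcomm, ← hS, mul_comm] at h
  have := le_of_mul_le_mul_right h hSpd.det_pos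
  simpa using this

/-- With `K1 = (I_{M1}+ρ12·H12†H12)⁻¹`, `K2 = (I_{M2}+ρ21·H21†H21)⁻¹`,
`K1u = K1/M1`, `K2u = K2/M2`:
`det(I + ρ11·H11·K1u·H11† + ρ21·H21·K2u·H21†) ≥
 det(I + ρ11·H11·K1·H11†)·det(I + ρ21·H21·K2u·H21†) / (M1^{min(M1,N1)}·((M2+1)/M2)^{min(M2,N1)})`. -/
theorem stmt_8 (M1 M2 N1 N2 : ℕ) (hM1 : 0 < M1) (hM2 : 0 < M2) (hN1 : 0 < N1) (hN2 : 0 < N2)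
    (H11 : Matrix (Fin N1) (Fin M1) ℂ) (H21 : Matrix (Fin N1) (Fin M2) ℂ)
    (H12 : Matrix (Fin N2) (Fin M1) ℂ) (H22 : Matrix (Fin N2) (Fin M2) ℂ)
    (ρ11 ρ12 ρ21 ρ22 : ℝ) (h11 : 0 ≤ ρ11) (h12 : 0 ≤ ρ12) (h21 : 0 ≤ ρ21) (h22 : 0 ≤ ρ22) :
    ((1 + (ρ11 : ℂ) • (H11 * KK H12 ρ12 * H11ᴴ)).det).re
        * ((1 + (ρ21 : ℂ) • (H21 * Ku H21 ρ21 * H21ᴴ)).det).re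
        / ((M1 : ℝ) ^ (min M1 N1) * (((M2 : ℝ) + 1) / M2) ^ (min M2 N1))
      ≤ ((1 + (ρ11 : ℂ) • (H11 * Ku H12 ρ12 * H11ᴴ)
          + (ρ21 : ℂ) • (H21 * Ku H21 ρ21 * H21ᴴ)).det).re := by
  set A := (ρ11 : ℂ) • (H11 * Ku H12 ρ12 * H11ᴴ) with hA
  set B := (ρ21 : ℂ) • (H21 * Ku H21 ρ21 * H21ᴴ) with hB
  have hApsd : A.PosSemidef :=
    posSemidef_smul_mul_mul_conjTranspose H11 (Ku_posSemidef H12 h12) h11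
  have hBpsd : B.PosSemidef :=
    posSemidef_smul_mul_mul_conjTranspose H21 (Ku_posSemidef H21 h21) h21
  have hApd := posDef_one_add hApsd
  have hX := (det_one_add_KK_le hM1 H11 H12 h11 h12).1
  have hY := (det_one_add_Ku_le hM2 H21 h21).1
  have hmono := (det_le_det_add hApd hBpsd).1
  have hApos := hApd.det_pos.1
  have hBpos := (posDef_one_add hBpsd).det_pos.1
  rw [← hA] at hX
  rw [← hB] at hY
  have hre_pow_mul : ((M1 : ℂ) ^ min M1 N1 * (1 + A).det).re =
      (M1 : ℝ) ^ min M1 N1 * (1 + A).det.re := by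
    rw [← Complex.re_ofReal_mul]; push_cast; rfl
  have hre_pow : ((((M2 : ℂ) + 1) / M2) ^ min M2 N1).re = (((M2 : ℝ) + 1) / M2) ^ min M2 N1 := by
    rw [← Complex.ofReal_re ((((M2 : ℝ) + 1) / M2) ^ min M2 N1)]; push_cast; rfl
  rw [hre_pow_mul] at hX
  rw [hre_pow] at hY
  simp only [Complex.zero_re] at hApos hBpos
  have hm1 : (0 : ℝ) < M1 := by exact_mod_cast hM1
  have hm2 : (0 : ℝ) < M2 := by exact_mod_cast hM2
  rw [div_le_iff₀ (by positivity)]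
  calc _ ≤ ((M1 : ℝ) ^ min M1 N1 * (1 + A).det.re) * (((M2 : ℝ) + 1) / M2) ^ min M2 N1 := by
        gcongr
    _ = (1 + A).det.re * ((M1 : ℝ) ^ min M1 N1 * (((M2 : ℝ) + 1) / M2) ^ min M2 N1) := by ring
    _ ≤ _ := by gcongr
end

section
/- With the channel setup below, the following determinant inequality holds: det(I_{N1} + (ρ21/M2)·H21·H21†) ≥ det(I_{N1} + ρ21·H21·H21†) · det(I_{N1} + ρ21·H21·K2u·H21†) / ( M2^{min(M2,N1)} · ((M2+1)/M2)^{min(M2,N1)} ), where all determinants are positive real numbers. -/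
open Matrix ComplexOrder

/-- The determinant of `1 + a • P`, for Hermitian `P`, is the product of the `1 + a * λ` over the
eigenvalues `λ` of `P`. -/
theorem det_one_add_smul_isHermitian {n : ℕ} {P : Matrix (Fin n) (Fin n) ℂ} (hP : P.IsHermitian)
    (a : ℝ) :
    (1 + (a : ℂ) • P).det = ((∏ i, (1 + a * hP.eigenvalues i) : ℝ) : ℂ) := by
  set U := (hP.eigenvectorUnitary : Matrix (Fin n) (Fin n) ℂ)
  set D : Matrix (Fin n) (Fin n) ℂ := diagonal (RCLike.ofReal ∘ hP.eigenvalues)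
  have hU : U * star U = 1 := Unitary.coe_mul_star_self _
  have hPD : P = U * D * star U := by
    simpa only [Unitary.conjStarAlgAut_apply] using hP.spectral_theorem
  have hconj : 1 + (a : ℂ) • P = U * (1 + (a : ℂ) • D) * star U := by
    rw [mul_add, add_mul, mul_one, hU, Matrix.mul_smul, Matrix.smul_mul, ← hPD]
  have hdiag : 1 + (a : ℂ) • D = diagonal fun i => ((1 + a * hP.eigenvalues i : ℝ) : ℂ) := by
    rw [← diagonal_one, ← diagonal_smul, diagonal_add]
    congr 1
    ext i
    simp
  rw [hconj, det_mul_right_comm, hU, one_mul, hdiag, det_diagonal, Complex.ofReal_prod]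

/-- Comparison of `det (1 + ((m + 1) / m) t P)` and `det (1 + (t / m) P)` for positive
semidefinite `P`. -/
theorem det_one_add_smul_posSemidef_le {n : ℕ} {P : Matrix (Fin n) (Fin n) ℂ} (hP : P.PosSemidef)
    {m t : ℝ} (hm : 0 < m) (ht : 0 ≤ t) :
    (1 + ((t + t / m : ℝ) : ℂ) • P).det.re
      ≤ (m + 1) ^ n * (1 + ((t / m : ℝ) : ℂ) • P).det.re := by
  have hdiv : 0 ≤ t / m := by positivity
  rw [det_one_add_smul_isHermitian hP.isHermitian, det_one_add_smul_isHermitian hP.isHermitian,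
    Complex.ofReal_re, Complex.ofReal_re]
  have hpow : (m + 1) ^ n = ∏ _i : Fin n, (m + 1) := by simp
  rw [hpow, ← Finset.prod_mul_distrib]
  refine Finset.prod_le_prod (fun i _ => ?_) fun i _ => ?_
  · have := hP.eigenvalues_nonneg i
    positivity
  · have hl := hP.eigenvalues_nonneg i
    have hmt : m * (t / m) = t := by field_simp
    have : (m + 1) * (1 + t / m * hP.isHermitian.eigenvalues i)
        = m + 1 + (t + t / m) * hP.isHermitian.eigenvalues i := by
      linear_combination hP.isHermitian.eigenvalues i * hmt
    rw [this]
    linarith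

/-- Sylvester's determinant identity for `1 + c • (H * Hᴴ)`. -/
theorem det_one_add_smul_mul_conjTranspose {m n : ℕ} (H : Matrix (Fin n) (Fin m) ℂ) (c : ℂ) :
    (1 + c • (H * Hᴴ)).det = (1 + c • (Hᴴ * H)).det := by
  rw [← Matrix.smul_mul, det_one_add_mul_comm, Matrix.mul_smul]

/-- The product of the two determinants involving `Ku` collapses to a single determinant. -/
theorem det_mul_det_Ku {m n : ℕ} (H : Matrix (Fin n) (Fin m) ℂ) {ρ : ℝ} (hρ : 0 ≤ ρ) :
    (1 + (ρ : ℂ) • (H * Hᴴ)).det * (1 + (ρ : ℂ) • (H * Ku H ρ * Hᴴ)).det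
      = (1 + ((ρ + ρ / m : ℝ) : ℂ) • (H * Hᴴ)).det := by
  have hρ' : (0 : ℂ) ≤ (ρ : ℂ) := by exact_mod_cast hρ
  have hG : IsUnit (1 + (ρ : ℂ) • (Hᴴ * H)).det :=
    (PosDef.one.add_posSemidef ((posSemidef_conjTranspose_mul_self H).smul hρ')).det_pos.ne'.isUnit
  have hsylv : (1 + (ρ : ℂ) • (H * Ku H ρ * Hᴴ)).det
      = (1 + ((ρ / m : ℝ) : ℂ) • (Hᴴ * H) * (1 + (ρ : ℂ) • (Hᴴ * H))⁻¹).det := by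
    rw [← Matrix.smul_mul, det_one_add_mul_comm, Ku, KK]
    congr 2
    simp [smul_smul, Matrix.mul_assoc, div_eq_mul_inv]
  rw [hsylv, det_one_add_smul_mul_conjTranspose, det_one_add_smul_mul_conjTranspose, mul_comm,
    ← det_mul, add_mul, one_mul, nonsing_inv_mul_cancel_right _ _ hG, add_assoc, ← add_smul,
    Complex.ofReal_add]

/-- With `K2u = (1/M2)·(I_{M2}+ρ21·H21†H21)⁻¹`:
`det(I + (ρ21/M2)·H21·H21†) ≥
 det(I + ρ21·H21·H21†)·det(I + ρ21·H21·K2u·H21†) / (M2^{min(M2,N1)}·((M2+1)/M2)^{min(M2,N1)})`. -/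
theorem stmt_9 (M1 M2 N1 N2 : ℕ) (hM1 : 0 < M1) (hM2 : 0 < M2) (hN1 : 0 < N1) (hN2 : 0 < N2)
    (H11 : Matrix (Fin N1) (Fin M1) ℂ) (H21 : Matrix (Fin N1) (Fin M2) ℂ)
    (H12 : Matrix (Fin N2) (Fin M1) ℂ) (H22 : Matrix (Fin N2) (Fin M2) ℂ)
    (ρ11 ρ12 ρ21 ρ22 : ℝ) (h11 : 0 ≤ ρ11) (h12 : 0 ≤ ρ12) (h21 : 0 ≤ ρ21) (h22 : 0 ≤ ρ22) :
    ((1 + (ρ21 : ℂ) • (H21 * H21ᴴ)).det).re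
        * ((1 + (ρ21 : ℂ) • (H21 * Ku H21 ρ21 * H21ᴴ)).det).re
        / ((M2 : ℝ) ^ (min M2 N1) * (((M2 : ℝ) + 1) / M2) ^ (min M2 N1))
      ≤ ((1 + ((ρ21 / M2 : ℝ) : ℂ) • (H21 * H21ᴴ)).det).re := by
  have hM : (0 : ℝ) < M2 := by exact_mod_cast hM2
  have hre : ((1 + (ρ21 : ℂ) • (H21 * H21ᴴ)).det).re
        * ((1 + (ρ21 : ℂ) • (H21 * Ku H21 ρ21 * H21ᴴ)).det).re
      = (1 + ((ρ21 + ρ21 / M2 : ℝ) : ℂ) • (H21 * H21ᴴ)).det.re := by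
    rw [← det_mul_det_Ku H21 h21,
      det_one_add_smul_isHermitian (posSemidef_self_mul_conjTranspose H21).isHermitian,
      Complex.re_ofReal_mul, Complex.ofReal_re]
  rw [hre, ← mul_pow, mul_div_cancel₀ _ hM.ne', div_le_iff₀' (by positivity)]
  rcases le_total M2 N1 with h | h
  · rw [min_eq_left h, det_one_add_smul_mul_conjTranspose, det_one_add_smul_mul_conjTranspose]
    exact det_one_add_smul_posSemidef_le (posSemidef_conjTranspose_mul_self H21) hM h21
  · rw [min_eq_right h]
    exact det_one_add_smul_posSemidef_le (posSemidef_self_mul_conjTranspose H21) hM h21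
end

section
/- With the channel setup below, the following determinant identity holds: det(I_{N2} + ρ12·H12·H12† + ρ22·H22·H22†) · det(I_{N1} + ρ11·H11·(I_{M1} + ρ12·H12†·H12)⁻¹·H11†) = det(I_{M2} + ρ22·H22†·(I_{N2} + ρ12·H12·H12†)⁻¹·H22) · det(I_{M1} + ρ12·H12†·H12 + ρ11·H11†·H11). -/
open Matrix ComplexOrder

namespace Matrix

lemma det_add_smul_mul {m n R : Type*} [Fintype m] [Fintype n] [DecidableEq m] [DecidableEq n]
    [CommRing R] {A : Matrix m m R} (hA : IsUnit A.det) (c : R) (U : Matrix m n R)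
    (V : Matrix n m R) :
    (A + c • (U * V)).det = A.det * (1 + c • (V * A⁻¹ * U)).det := by
  rw [← Matrix.smul_mul, det_add_mul _ _ hA, Matrix.mul_smul]

lemma det_one_add_smul_mul_comm {m n R : Type*} [Fintype m] [Fintype n] [DecidableEq m]
    [DecidableEq n] [CommRing R] (c : R) (U : Matrix m n R) (V : Matrix n m R) :
    (1 + c • (U * V)).det = (1 + c • (V * U)).det := by
  rw [← Matrix.smul_mul, det_one_add_mul_comm, Matrix.mul_smul]

lemma isUnit_det_one_add_smul_mul_conjTranspose {m n : Type*} [Fintype m] [Fintype n]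
    [DecidableEq m] {c : ℝ} (hc : 0 ≤ c) (H : Matrix m n ℂ) :
    IsUnit (1 + (c : ℂ) • (H * Hᴴ)).det :=
  (PosDef.one.add_posSemidef ((posSemidef_self_mul_conjTranspose H).smul
    (Complex.zero_le_real.2 hc))).det_pos.ne'.isUnit

end Matrix

/-- The determinant identity
`det(I_{N2} + ρ12·H12H12† + ρ22·H22H22†) · det(I_{N1} + ρ11·H11·(I_{M1}+ρ12·H12†H12)⁻¹·H11†)
 = det(I_{M2} + ρ22·H22†·(I_{N2}+ρ12·H12H12†)⁻¹·H22) · det(I_{M1} + ρ12·H12†H12 + ρ11·H11†H11)`. -/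
theorem stmt_13 (M1 M2 N1 N2 : ℕ) (hM1 : 0 < M1) (hM2 : 0 < M2) (hN1 : 0 < N1) (hN2 : 0 < N2)
    (H11 : Matrix (Fin N1) (Fin M1) ℂ) (H21 : Matrix (Fin N1) (Fin M2) ℂ)
    (H12 : Matrix (Fin N2) (Fin M1) ℂ) (H22 : Matrix (Fin N2) (Fin M2) ℂ)
    (ρ11 ρ12 ρ21 ρ22 : ℝ) (h11 : 0 ≤ ρ11) (h12 : 0 ≤ ρ12) (h21 : 0 ≤ ρ21) (h22 : 0 ≤ ρ22) :
    (1 + (ρ12 : ℂ) • (H12 * H12ᴴ) + (ρ22 : ℂ) • (H22 * H22ᴴ)).det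
        * (1 + (ρ11 : ℂ) • (H11 * (1 + (ρ12 : ℂ) • (H12ᴴ * H12))⁻¹ * H11ᴴ)).det
      = (1 + (ρ22 : ℂ) • (H22ᴴ * (1 + (ρ12 : ℂ) • (H12 * H12ᴴ))⁻¹ * H22)).det
        * (1 + (ρ12 : ℂ) • (H12ᴴ * H12) + (ρ11 : ℂ) • (H11ᴴ * H11)).det := by
  have hA := isUnit_det_one_add_smul_mul_conjTranspose h12 H12
  have hdet := det_one_add_smul_mul_comm (ρ12 : ℂ) H12 H12ᴴ
  have hB : IsUnit (1 + (ρ12 : ℂ) • (H12ᴴ * H12)).det := hdet ▸ hA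
  rw [det_add_smul_mul hA, det_add_smul_mul hB, hdet]
  ring
end

section
/- With the channel setup below, the following determinant identity holds: det(I_{N1} + ρ21·H21·H21† + ρ11·H11·K1·H11†) · det(I_{N2} + ρ12·H12·H12† + ρ22·H22·K2·H22†) = det(I_{M1} + ρ12·H12†·H12 + ρ11·H11†·(I_{N1} + ρ21·H21·H21†)⁻¹·H11) · det(I_{M2} + ρ21·H21†·H21 + ρ22·H22†·(I_{N2} + ρ12·H12·H12†)⁻¹·H22), where K1 = (I_{M1} + ρ12·H12†·H12)⁻¹ and K2 = (I_{M2} + ρ21·H21†·H21)⁻¹. -/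
open Matrix ComplexOrder

/-- The two Schur complement expansions of the determinant of a block matrix agree. -/
theorem det_mul_det_add_smul_mul_inv_mul {m n R : Type*} [Fintype m] [Fintype n] [DecidableEq m]
    [DecidableEq n] [CommRing R] (A : Matrix m m R) (B : Matrix m n R) (C : Matrix n m R)
    (D : Matrix n n R) (c : R) (hA : IsUnit A.det) (hD : IsUnit D.det) :
    D.det * (A + c • (B * D⁻¹ * C)).det = A.det * (D + c • (C * A⁻¹ * B)).det := by
  let := invertibleOfIsUnitDet A hA
  let := invertibleOfIsUnitDet D hD
  have h₁ := det_fromBlocks₁₁ A (-(c • B)) C D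
  have h₂ := det_fromBlocks₂₂ A (-(c • B)) C D
  simp only [invOf_eq_nonsing_inv, Matrix.neg_mul, Matrix.mul_neg, sub_neg_eq_add,
    Matrix.smul_mul, Matrix.mul_smul] at h₁ h₂
  exact h₂.symm.trans h₁

theorem det_one_add_smul_mul_conjTranspose_ne_zero {m n : Type*} [Fintype m] [Fintype n]
    [DecidableEq m] (H : Matrix m n ℂ) {r : ℝ} (hr : 0 ≤ r) :
    (1 + (r : ℂ) • (H * Hᴴ)).det ≠ 0 :=
  (PosDef.one.add_posSemidef
    ((posSemidef_self_mul_conjTranspose H).smul (Complex.zero_le_real.mpr hr))).det_pos.ne'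

theorem det_one_add_smul_mul_comm {m n R : Type*} [Fintype m] [Fintype n] [DecidableEq m]
    [DecidableEq n] [CommRing R] (A : Matrix m n R) (B : Matrix n m R) (c : R) :
    (1 + c • (A * B)).det = (1 + c • (B * A)).det := by
  rw [← Matrix.smul_mul, det_one_add_mul_comm, Matrix.mul_smul]

/-- With `K1 = (I_{M1}+ρ12·H12†H12)⁻¹` and `K2 = (I_{M2}+ρ21·H21†H21)⁻¹`,
`det(I_{N1} + ρ21·H21H21† + ρ11·H11K1H11†) · det(I_{N2} + ρ12·H12H12† + ρ22·H22K2H22†)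
 = det(I_{M1} + ρ12·H12†H12 + ρ11·H11†·(I_{N1}+ρ21·H21H21†)⁻¹·H11)
   · det(I_{M2} + ρ21·H21†H21 + ρ22·H22†·(I_{N2}+ρ12·H12H12†)⁻¹·H22)`. -/
theorem stmt_14 (M1 M2 N1 N2 : ℕ) (hM1 : 0 < M1) (hM2 : 0 < M2) (hN1 : 0 < N1) (hN2 : 0 < N2)
    (H11 : Matrix (Fin N1) (Fin M1) ℂ) (H21 : Matrix (Fin N1) (Fin M2) ℂ)
    (H12 : Matrix (Fin N2) (Fin M1) ℂ) (H22 : Matrix (Fin N2) (Fin M2) ℂ)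
    (ρ11 ρ12 ρ21 ρ22 : ℝ) (h11 : 0 ≤ ρ11) (h12 : 0 ≤ ρ12) (h21 : 0 ≤ ρ21) (h22 : 0 ≤ ρ22) :
    (1 + (ρ21 : ℂ) • (H21 * H21ᴴ)
        + (ρ11 : ℂ) • (H11 * (1 + (ρ12 : ℂ) • (H12ᴴ * H12))⁻¹ * H11ᴴ)).det
      * (1 + (ρ12 : ℂ) • (H12 * H12ᴴ)
        + (ρ22 : ℂ) • (H22 * (1 + (ρ21 : ℂ) • (H21ᴴ * H21))⁻¹ * H22ᴴ)).det
    = (1 + (ρ12 : ℂ) • (H12ᴴ * H12)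
        + (ρ11 : ℂ) • (H11ᴴ * (1 + (ρ21 : ℂ) • (H21 * H21ᴴ))⁻¹ * H11)).det
      * (1 + (ρ21 : ℂ) • (H21ᴴ * H21)
        + (ρ22 : ℂ) • (H22ᴴ * (1 + (ρ12 : ℂ) • (H12 * H12ᴴ))⁻¹ * H22)).det := by
  have hA₁ := det_one_add_smul_mul_conjTranspose_ne_zero H21 h21
  have hA₂ := det_one_add_smul_mul_conjTranspose_ne_zero H12 h12
  have e₁ := det_one_add_smul_mul_comm H21 H21ᴴ (ρ21 : ℂ)
  have e₂ := det_one_add_smul_mul_comm H12 H12ᴴ (ρ12 : ℂ)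
  have s₁ := det_mul_det_add_smul_mul_inv_mul _ H11 H11ᴴ _ (ρ11 : ℂ) hA₁.isUnit (e₂ ▸ hA₂).isUnit
  have s₂ := det_mul_det_add_smul_mul_inv_mul _ H22 H22ᴴ _ (ρ22 : ℂ) hA₂.isUnit (e₁ ▸ hA₁).isUnit
  rw [← e₂] at s₁
  rw [← e₁] at s₂
  refine mul_left_cancel₀ (mul_ne_zero hA₂ hA₁) ?_
  rw [mul_mul_mul_comm, s₁, s₂, mul_mul_mul_comm, mul_comm (det _) (det _)]
end

section
/- With the channel setup and the outer-bound region R^u defined below, the forward region equals the reverse region: the set R^u(H11,H12,H21,H22; ρ11,ρ12,ρ21,ρ22) of pairs (R1,R2) is equal to the set obtained from the same seven defining inequalities after simultaneously replacing H11 by H11ᵀ, H22 by H22ᵀ, H12 by H21ᵀ, H21 by H12ᵀ, interchanging ρ12 and ρ21, and interchanging the antenna numbers M1 ↔ N1 and M2 ↔ N2 (so that in the reverse region K1 becomes (I_{N1} + ρ21·(H21ᵀ)†·H21ᵀ)⁻¹ and K2 becomes (I_{N2} + ρ12·(H12ᵀ)†·H12ᵀ)⁻¹, with identity matrices of the correspondingly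 swapped sizes). -/
open Matrix ComplexOrder

/-- Base-2 logarithm of the (real part of the) determinant. -/
noncomputable def logdet {n : ℕ} (A : Matrix (Fin n) (Fin n) ℂ) : ℝ :=
  Real.logb 2 A.det.re

/-- The outer-bound region `R^u(H, ρ̄)` of the 2-user MIMO interference channel
(Lemma 1 of the paper): the set of nonnegative rate pairs `(R1, R2)` satisfying the
seven bounds (i)–(vii). -/
noncomputable def Ru {M1 N1 M2 N2 : ℕ}
    (H11 : Matrix (Fin N1) (Fin M1) ℂ) (H12 : Matrix (Fin N2) (Fin M1) ℂ)
    (H21 : Matrix (Fin N1) (Fin M2) ℂ) (H22 : Matrix (Fin N2) (Fin M2) ℂ)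
    (ρ11 ρ12 ρ21 ρ22 : ℝ) : Set (ℝ × ℝ) :=
  {p : ℝ × ℝ | 0 ≤ p.1 ∧ 0 ≤ p.2 ∧
    p.1 ≤ logdet (1 + (ρ11 : ℂ) • (H11 * H11ᴴ)) ∧
    p.2 ≤ logdet (1 + (ρ22 : ℂ) • (H22 * H22ᴴ)) ∧
    p.1 + p.2 ≤ logdet (1 + (ρ12 : ℂ) • (H12 * H12ᴴ) + (ρ22 : ℂ) • (H22 * H22ᴴ))
        + logdet (1 + (ρ11 : ℂ) • (H11 * KK H12 ρ12 * H11ᴴ)) ∧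
    p.1 + p.2 ≤ logdet (1 + (ρ21 : ℂ) • (H21 * H21ᴴ) + (ρ11 : ℂ) • (H11 * H11ᴴ))
        + logdet (1 + (ρ22 : ℂ) • (H22 * KK H21 ρ21 * H22ᴴ)) ∧
    p.1 + p.2 ≤ logdet (1 + (ρ21 : ℂ) • (H21 * H21ᴴ)
            + (ρ11 : ℂ) • (H11 * KK H12 ρ12 * H11ᴴ))
        + logdet (1 + (ρ12 : ℂ) • (H12 * H12ᴴ)
            + (ρ22 : ℂ) • (H22 * KK H21 ρ21 * H22ᴴ)) ∧
    2 * p.1 + p.2 ≤ logdet (1 + (ρ21 : ℂ) • (H21 * H21ᴴ) + (ρ11 : ℂ) • (H11 * H11ᴴ))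
        + logdet (1 + (ρ11 : ℂ) • (H11 * KK H12 ρ12 * H11ᴴ))
        + logdet (1 + (ρ12 : ℂ) • (H12 * H12ᴴ)
            + (ρ22 : ℂ) • (H22 * KK H21 ρ21 * H22ᴴ)) ∧
    p.1 + 2 * p.2 ≤ logdet (1 + (ρ12 : ℂ) • (H12 * H12ᴴ) + (ρ22 : ℂ) • (H22 * H22ᴴ))
        + logdet (1 + (ρ22 : ℂ) • (H22 * KK H21 ρ21 * H22ᴴ))
        + logdet (1 + (ρ21 : ℂ) • (H21 * H21ᴴ)
            + (ρ11 : ℂ) • (H11 * KK H12 ρ12 * H11ᴴ))}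

/-- The two Schur complement expansions of the determinant of a block matrix. -/
theorem det_add_smul_mul_inv_mul {m n : ℕ} {A : Matrix (Fin n) (Fin n) ℂ}
    {B : Matrix (Fin m) (Fin m) ℂ} (hA : IsUnit A) (hB : IsUnit B)
    (H : Matrix (Fin n) (Fin m) ℂ) (c : ℂ) :
    (A + c • (H * B⁻¹ * Hᴴ)).det * B.det = (B + c • (Hᴴ * A⁻¹ * H)).det * A.det := by
  let := hA.invertible
  let := hB.invertible
  have h₁ := det_fromBlocks₁₁ A (-(c • H)) Hᴴ B
  have h₂ := det_fromBlocks₂₂ A (-(c • H)) Hᴴ B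
  simp only [invOf_eq_nonsing_inv, Matrix.mul_neg, Matrix.neg_mul, sub_neg_eq_add,
    Matrix.mul_smul, Matrix.smul_mul] at h₁ h₂
  rw [mul_comm, ← h₂, h₁, mul_comm]

theorem logdet_transpose {n : ℕ} (A : Matrix (Fin n) (Fin n) ℂ) : logdet Aᵀ = logdet A := by
  rw [logdet, logdet, det_transpose]

/-- The determinant of a positive definite matrix is a positive real, so `logdet` turns products of
such determinants into sums. -/
theorem logdet_add_logdet {m n : ℕ} {A : Matrix (Fin n) (Fin n) ℂ}
    {B : Matrix (Fin m) (Fin m) ℂ} (hA : A.PosDef) (hB : B.PosDef) :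
    logdet A + logdet B = Real.logb 2 (A.det * B.det).re := by
  obtain ⟨ha, ha'⟩ := Complex.pos_iff.mp hA.det_pos
  obtain ⟨hb, hb'⟩ := Complex.pos_iff.mp hB.det_pos
  rw [logdet, logdet, Complex.mul_re, ← ha', zero_mul, sub_zero, Real.logb_mul ha.ne' hb.ne']

theorem posSemidef_smul_mul_conjTranspose {m n : ℕ} (H : Matrix (Fin n) (Fin m) ℂ) {ρ : ℝ}
    (hρ : 0 ≤ ρ) : ((ρ : ℂ) • (H * Hᴴ)).PosSemidef :=
  (posSemidef_self_mul_conjTranspose H).smul (by exact_mod_cast hρ)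

theorem posDef_one_add_smul_mul_conjTranspose {m n : ℕ} (H : Matrix (Fin n) (Fin m) ℂ) {ρ : ℝ}
    (hρ : 0 ≤ ρ) : (1 + (ρ : ℂ) • (H * Hᴴ)).PosDef :=
  PosDef.one.add_posSemidef (posSemidef_smul_mul_conjTranspose H hρ)

theorem posDef_one_add_smul_conjTranspose_mul {m n : ℕ} (H : Matrix (Fin n) (Fin m) ℂ) {ρ : ℝ}
    (hρ : 0 ≤ ρ) : (1 + (ρ : ℂ) • (Hᴴ * H)).PosDef := by
  simpa using posDef_one_add_smul_mul_conjTranspose Hᴴ hρ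

theorem posDef_add_smul_mul_inv_mul {m n : ℕ} {A : Matrix (Fin n) (Fin n) ℂ}
    {B : Matrix (Fin m) (Fin m) ℂ} (hA : A.PosDef) (hB : B.PosDef)
    (H : Matrix (Fin n) (Fin m) ℂ) {ρ : ℝ} (hρ : 0 ≤ ρ) :
    (A + (ρ : ℂ) • (H * B⁻¹ * Hᴴ)).PosDef :=
  hA.add_posSemidef
    ((hB.inv.posSemidef.mul_mul_conjTranspose_same H).smul (by exact_mod_cast hρ))

theorem logdet_add_smul_mul_inv_mul {m n : ℕ} {A : Matrix (Fin n) (Fin n) ℂ}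
    {B : Matrix (Fin m) (Fin m) ℂ} (hA : A.PosDef) (hB : B.PosDef)
    (H : Matrix (Fin n) (Fin m) ℂ) {ρ : ℝ} (hρ : 0 ≤ ρ) :
    logdet (A + (ρ : ℂ) • (H * B⁻¹ * Hᴴ)) + logdet B
      = logdet (B + (ρ : ℂ) • (Hᴴ * A⁻¹ * H)) + logdet A := by
  have h := posDef_add_smul_mul_inv_mul hB hA Hᴴ hρ
  rw [conjTranspose_conjTranspose] at h
  rw [logdet_add_logdet (posDef_add_smul_mul_inv_mul hA hB H hρ) hB, logdet_add_logdet h hA,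
    det_add_smul_mul_inv_mul hA.isUnit hB.isUnit]

theorem conjTranspose_transpose_comm {m n : ℕ} (H : Matrix (Fin n) (Fin m) ℂ) :
    Hᵀᴴ = Hᴴᵀ := rfl

theorem KK_transpose {m n : ℕ} (H : Matrix (Fin n) (Fin m) ℂ) (ρ : ℝ) :
    KK Hᵀ ρ = ((1 + (ρ : ℂ) • (H * Hᴴ))⁻¹)ᵀ := by
  simp only [KK, transpose_nonsing_inv, transpose_add, transpose_one, transpose_smul,
    transpose_mul, conjTranspose_transpose_comm]

theorem logdet_one_add_smul_mul_conjTranspose_comm {m n : ℕ} (H : Matrix (Fin n) (Fin m) ℂ)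
    {ρ : ℝ} (hρ : 0 ≤ ρ) :
    logdet (1 + (ρ : ℂ) • (H * Hᴴ)) = logdet (1 + (ρ : ℂ) • (Hᴴ * H)) := by
  have h := logdet_add_smul_mul_inv_mul (.one : (1 : Matrix (Fin n) (Fin n) ℂ).PosDef)
    (.one : (1 : Matrix (Fin m) (Fin m) ℂ).PosDef) H hρ
  simpa [logdet] using h

theorem logdet_one_add_smul_transpose {m n : ℕ} (H : Matrix (Fin n) (Fin m) ℂ) {ρ : ℝ}
    (hρ : 0 ≤ ρ) :
    logdet (1 + (ρ : ℂ) • (Hᵀ * Hᵀᴴ)) = logdet (1 + (ρ : ℂ) • (H * Hᴴ)) := by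
  rw [logdet_one_add_smul_mul_conjTranspose_comm H hρ, ← logdet_transpose]
  simp only [transpose_add, transpose_one, transpose_smul, transpose_mul, transpose_transpose,
    conjTranspose_transpose_comm]

/-- Reciprocity for a link `H` without interference at its receiver. -/
theorem logdet_reverse_sum {m n k : ℕ} (H : Matrix (Fin n) (Fin m) ℂ)
    (G : Matrix (Fin k) (Fin m) ℂ) {ρ τ : ℝ} (hρ : 0 ≤ ρ) (hτ : 0 ≤ τ) :
    logdet (1 + (τ : ℂ) • (Gᵀ * Gᵀᴴ) + (ρ : ℂ) • (Hᵀ * Hᵀᴴ))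
      = logdet (1 + (ρ : ℂ) • (H * KK G τ * Hᴴ)) + logdet (1 + (τ : ℂ) • (G * Gᴴ)) := by
  have h := logdet_add_smul_mul_inv_mul PosDef.one
    (posDef_one_add_smul_conjTranspose_mul G hτ) H hρ
  rw [logdet_one_add_smul_mul_conjTranspose_comm G hτ, KK, h, ← logdet_transpose]
  simp [logdet, transpose_mul, conjTranspose_transpose_comm]

/-- Reciprocity for a link `H` with interference `F` at its receiver and interference `G` caused
by its transmitter. -/
theorem logdet_reverse_interference {m n k l : ℕ} (H : Matrix (Fin n) (Fin m) ℂ)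
    (F : Matrix (Fin n) (Fin l) ℂ) (G : Matrix (Fin k) (Fin m) ℂ) {ρ σ τ : ℝ}
    (hρ : 0 ≤ ρ) (hσ : 0 ≤ σ) (hτ : 0 ≤ τ) :
    logdet (1 + (τ : ℂ) • (Gᵀ * Gᵀᴴ) + (ρ : ℂ) • (Hᵀ * KK Fᵀ σ * Hᵀᴴ))
        + logdet (1 + (σ : ℂ) • (F * Fᴴ))
      = logdet (1 + (σ : ℂ) • (F * Fᴴ) + (ρ : ℂ) • (H * KK G τ * Hᴴ))
        + logdet (1 + (τ : ℂ) • (G * Gᴴ)) := by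
  have h := logdet_add_smul_mul_inv_mul (posDef_one_add_smul_mul_conjTranspose F hσ)
    (posDef_one_add_smul_conjTranspose_mul G hτ) H hρ
  rw [logdet_one_add_smul_mul_conjTranspose_comm G hτ, KK_transpose, KK, h, ← logdet_transpose]
  simp only [transpose_add, transpose_one, transpose_smul, transpose_mul, transpose_transpose,
    conjTranspose_transpose_comm, Matrix.mul_assoc]

/-- Lemma 6 of the paper. The outer-bound region of the forward
interference channel equals the outer-bound region of the reverse channel, obtained by
replacing `H11 ↦ H11ᵀ`, `H22 ↦ H22ᵀ`, `H12 ↦ H21ᵀ`, `H21 ↦ H12ᵀ`, interchanging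
`ρ12 ↔ ρ21` and the antenna numbers `M1 ↔ N1`, `M2 ↔ N2`. -/
theorem stmt_15 (M1 N1 M2 N2 : ℕ) (hM1 : 0 < M1) (hN1 : 0 < N1) (hM2 : 0 < M2) (hN2 : 0 < N2)
    (H11 : Matrix (Fin N1) (Fin M1) ℂ) (H12 : Matrix (Fin N2) (Fin M1) ℂ)
    (H21 : Matrix (Fin N1) (Fin M2) ℂ) (H22 : Matrix (Fin N2) (Fin M2) ℂ)
    (ρ11 ρ12 ρ21 ρ22 : ℝ) (h11 : 0 ≤ ρ11) (h12 : 0 ≤ ρ12) (h21 : 0 ≤ ρ21) (h22 : 0 ≤ ρ22) :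
    Ru H11 H12 H21 H22 ρ11 ρ12 ρ21 ρ22
      = Ru H11ᵀ H21ᵀ H12ᵀ H22ᵀ ρ11 ρ21 ρ12 ρ22 := by
  have a₁ := logdet_reverse_sum H11 H12 h11 h12
  have a₂ := logdet_reverse_sum H22 H21 h22 h21
  have b₁ := logdet_reverse_sum H11ᵀ H21ᵀ h11 h21
  have b₂ := logdet_reverse_sum H22ᵀ H12ᵀ h22 h12
  have c₁ := logdet_reverse_interference H11 H21 H12 h11 h21 h12
  have c₂ := logdet_reverse_interference H22 H12 H21 h22 h12 h21
  rw [logdet_one_add_smul_transpose _ (by assumption)] at b₁ b₂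
  simp only [transpose_transpose] at b₁ b₂
  ext p
  simp only [Ru, Set.mem_ofPred_eq]
  rw [logdet_one_add_smul_transpose H11 h11, logdet_one_add_smul_transpose H22 h22]
  constructor <;> rintro ⟨p₁, p₂, i, ii, iii, iv, v, vi, vii⟩ <;>
    refine ⟨p₁, p₂, i, ii, ?_, ?_, ?_, ?_, ?_⟩ <;> linarith
end

section
/- With the channel setup, explicit Gaussian Han–Kobayashi quantities, constants n1*, n2* and region R_a* defined below, R_a* is contained in the region R_2: every pair (R1,R2) ∈ R_a* satisfies all seven inequalities R1 ≤ Id1; R2 ≤ Id2; R1+R2 ≤ Ig2 + Ia1; R1+R2 ≤ Ig1 + Ia2; R1+R2 ≤ Ie1 + Ie2; 2R1+R2 ≤ Ig1 + Ia1 + Ie2; R1+2R2 ≤ Ig2 + Ia2 + Ie1. -/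
open Matrix ComplexOrder

/-- `τ_{ji}` at receiver `i`. -/
noncomputable def tauI {mc n : ℕ} (Hc : Matrix (Fin n) (Fin mc) ℂ) (ρc : ℝ) : ℝ :=
  logdet (1 + (ρc : ℂ) • (Hc * Ku Hc ρc * Hcᴴ))

/-- `Ia_i = log det(I + ρd·Hd·Kdu·Hd† + ρc·Hc·Kcu·Hc†) − τ`. -/
noncomputable def Ia {md mc n nx : ℕ} (Hd : Matrix (Fin n) (Fin md) ℂ)
    (Hc : Matrix (Fin n) (Fin mc) ℂ) (Hx : Matrix (Fin nx) (Fin md) ℂ)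
    (ρd ρx ρc : ℝ) : ℝ :=
  logdet (1 + (ρd : ℂ) • (Hd * Ku Hx ρx * Hdᴴ) + (ρc : ℂ) • (Hc * Ku Hc ρc * Hcᴴ))
    - tauI Hc ρc

/-- `Id_i = log det(I + (ρd/md)·Hd·Hd† + ρc·Hc·Kcu·Hc†) − τ`. -/
noncomputable def Id' {md mc n : ℕ} (Hd : Matrix (Fin n) (Fin md) ℂ)
    (Hc : Matrix (Fin n) (Fin mc) ℂ) (ρd ρc : ℝ) : ℝ :=
  logdet (1 + ((ρd / md : ℝ) : ℂ) • (Hd * Hdᴴ) + (ρc : ℂ) • (Hc * Ku Hc ρc * Hcᴴ))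
    - tauI Hc ρc

/-- `Ie_i = log det(I + (ρc/mc)·Hc·Hc† + ρd·Hd·Kdu·Hd†) − τ`. -/
noncomputable def Ie {md mc n nx : ℕ} (Hd : Matrix (Fin n) (Fin md) ℂ)
    (Hc : Matrix (Fin n) (Fin mc) ℂ) (Hx : Matrix (Fin nx) (Fin md) ℂ)
    (ρd ρx ρc : ℝ) : ℝ :=
  logdet (1 + ((ρc / mc : ℝ) : ℂ) • (Hc * Hcᴴ) + (ρd : ℂ) • (Hd * Ku Hx ρx * Hdᴴ))
    - tauI Hc ρc

/-- `Ig_i = log det(I + (ρc/mc)·Hc·Hc† + (ρd/md)·Hd·Hd†) − τ`. -/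
noncomputable def Ig {md mc n : ℕ} (Hd : Matrix (Fin n) (Fin md) ℂ)
    (Hc : Matrix (Fin n) (Fin mc) ℂ) (ρd ρc : ℝ) : ℝ :=
  logdet (1 + ((ρc / mc : ℝ) : ℂ) • (Hc * Hcᴴ) + ((ρd / md : ℝ) : ℂ) • (Hd * Hdᴴ))
    - tauI Hc ρc

/-- The constant `n1* = min(N1, M1+M2)·log(max(M1,M2)) + min(M2,N1)·log((M2+1)/M2)`. -/
noncomputable def n1s (M1 M2 N1 : ℕ) : ℝ :=
  (min N1 (M1 + M2) : ℝ) * Real.logb 2 (max M1 M2 : ℝ)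
    + (min M2 N1 : ℝ) * Real.logb 2 (((M2 : ℝ) + 1) / M2)

/-- The constant `n2* = min(N2, M1+M2)·log(max(M1,M2)) + min(M1,N2)·log((M1+1)/M1)`. -/
noncomputable def n2s (M1 M2 N2 : ℕ) : ℝ :=
  (min N2 (M1 + M2) : ℝ) * Real.logb 2 (max M1 M2 : ℝ)
    + (min M1 N2 : ℝ) * Real.logb 2 (((M1 : ℝ) + 1) / M1)

/-- The achievable region `R_a*(H, ρ̄)` (Lemma 7 of the paper). -/
noncomputable def Rastar {M1 N1 M2 N2 : ℕ}
    (H11 : Matrix (Fin N1) (Fin M1) ℂ) (H12 : Matrix (Fin N2) (Fin M1) ℂ)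
    (H21 : Matrix (Fin N1) (Fin M2) ℂ) (H22 : Matrix (Fin N2) (Fin M2) ℂ)
    (ρ11 ρ12 ρ21 ρ22 : ℝ) : Set (ℝ × ℝ) :=
  {p : ℝ × ℝ | 0 ≤ p.1 ∧ 0 ≤ p.2 ∧
    p.1 ≤ max (logdet (1 + (ρ11 : ℂ) • (H11 * H11ᴴ)) - n1s M1 M2 N1) 0 ∧
    p.2 ≤ max (logdet (1 + (ρ22 : ℂ) • (H22 * H22ᴴ)) - n2s M1 M2 N2) 0 ∧
    p.1 + p.2 ≤ max (logdet (1 + (ρ12 : ℂ) • (H12 * H12ᴴ) + (ρ22 : ℂ) • (H22 * H22ᴴ))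
        + logdet (1 + (ρ11 : ℂ) • (H11 * KK H12 ρ12 * H11ᴴ))
        - (n1s M1 M2 N1 + n2s M1 M2 N2)) 0 ∧
    p.1 + p.2 ≤ max (logdet (1 + (ρ21 : ℂ) • (H21 * H21ᴴ) + (ρ11 : ℂ) • (H11 * H11ᴴ))
        + logdet (1 + (ρ22 : ℂ) • (H22 * KK H21 ρ21 * H22ᴴ))
        - (n1s M1 M2 N1 + n2s M1 M2 N2)) 0 ∧
    p.1 + p.2 ≤ max (logdet (1 + (ρ21 : ℂ) • (H21 * H21ᴴ)
            + (ρ11 : ℂ) • (H11 * KK H12 ρ12 * H11ᴴ))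
        + logdet (1 + (ρ12 : ℂ) • (H12 * H12ᴴ)
            + (ρ22 : ℂ) • (H22 * KK H21 ρ21 * H22ᴴ))
        - (n1s M1 M2 N1 + n2s M1 M2 N2)) 0 ∧
    2 * p.1 + p.2 ≤ max (logdet (1 + (ρ21 : ℂ) • (H21 * H21ᴴ)
            + (ρ11 : ℂ) • (H11 * H11ᴴ))
        + logdet (1 + (ρ11 : ℂ) • (H11 * KK H12 ρ12 * H11ᴴ))
        + logdet (1 + (ρ12 : ℂ) • (H12 * H12ᴴ)
            + (ρ22 : ℂ) • (H22 * KK H21 ρ21 * H22ᴴ))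
        - (2 * n1s M1 M2 N1 + n2s M1 M2 N2)) 0 ∧
    p.1 + 2 * p.2 ≤ max (logdet (1 + (ρ12 : ℂ) • (H12 * H12ᴴ)
            + (ρ22 : ℂ) • (H22 * H22ᴴ))
        + logdet (1 + (ρ22 : ℂ) • (H22 * KK H21 ρ21 * H22ᴴ))
        + logdet (1 + (ρ21 : ℂ) • (H21 * H21ᴴ)
            + (ρ11 : ℂ) • (H11 * KK H12 ρ12 * H11ᴴ))
        - (n1s M1 M2 N1 + 2 * n2s M1 M2 N2)) 0}

namespace Matrix

/-- A two-sided conjugate sum `H X Hᴴ + G Y Gᴴ` has rank at most the total number of columns. -/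
lemma rank_mul_mul_add_mul_mul_le {n p q : ℕ} (H : Matrix (Fin n) (Fin p) ℂ)
    (X : Matrix (Fin p) (Fin p) ℂ) (G : Matrix (Fin n) (Fin q) ℂ) (Y : Matrix (Fin q) (Fin q) ℂ) :
    (H * X * Hᴴ + G * Y * Gᴴ).rank ≤ min n (p + q) := by
  refine le_min (by simpa using rank_le_height (H * X * Hᴴ + G * Y * Gᴴ)) ?_
  rw [← fromCols_mul_fromRows]
  refine (rank_mul_le_left _ _).trans ((rank_le_card_width _).trans (by simp))

variable {n : Type*} [Fintype n] [DecidableEq n] {A B P : Matrix n n ℂ}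

/-- The spectral formula for `det (1 + c P)`. -/
lemma IsHermitian.det_one_add_smul_s18 (hP : P.IsHermitian) (c : ℝ) :
    (1 + (c : ℂ) • P).det = ((∏ i, (1 + c * hP.eigenvalues i) : ℝ) : ℂ) := by
  set U : Matrix n n ℂ := ↑hP.eigenvectorUnitary
  have hUU : U * star U = 1 := Unitary.coe_mul_star_self _
  have hspec : P = U * diagonal (RCLike.ofReal ∘ hP.eigenvalues) * star U := by
    conv_lhs => rw [hP.spectral_theorem, Unitary.conjStarAlgAut_apply]
  have hsum : 1 + (c : ℂ) • P = U * diagonal (fun i => ((1 + c * hP.eigenvalues i : ℝ) : ℂ))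
      * star U := by
    have : diagonal (fun i => ((1 + c * hP.eigenvalues i : ℝ) : ℂ))
        = 1 + (c : ℂ) • diagonal (RCLike.ofReal ∘ hP.eigenvalues) := by
      ext i j
      by_cases h : i = j <;> simp [h]
    rw [this, mul_add, add_mul, mul_one, hUU, Matrix.mul_smul, Matrix.smul_mul, ← hspec]
  have hdet : U.det * (star U).det = 1 := by rw [← det_mul, hUU, det_one]
  rw [hsum, det_mul, det_mul, mul_right_comm, hdet, one_mul, det_diagonal]
  push_cast
  rfl

lemma PosSemidef.one_le_det_one_add_re (hP : P.PosSemidef) : 1 ≤ (1 + P).det.re := by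
  have h := hP.1.det_one_add_smul_s18 1
  rw [Complex.ofReal_one, one_smul] at h
  rw [h, Complex.ofReal_re]
  exact Finset.one_le_prod fun i _ => by linarith [hP.eigenvalues_nonneg i]

lemma PosDef.det_re_pos (hA : A.PosDef) : 0 < A.det.re :=
  (Complex.pos_iff.mp hA.det_pos).1

open scoped MatrixOrder in
/-- The determinant is monotone on positive definite matrices. -/
lemma PosDef.det_re_le_det_add_re (hA : A.PosDef) (hB : B.PosSemidef) :
    A.det.re ≤ (A + B).det.re := by
  obtain ⟨C, hC : A = Cᴴ * C⟩ :=
    CStarAlgebra.nonneg_iff_eq_star_mul_self.mp (nonneg_iff_posSemidef.mpr hA.posSemidef)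
  have hdetA : A.det = star C.det * C.det := by rw [hC, det_mul, det_conjTranspose]
  have hCu : IsUnit C.det := by
    refine isUnit_iff_ne_zero.mpr fun h => hA.det_pos.ne' ?_
    rw [hdetA, h, mul_zero]
  have hCC : C⁻¹ᴴ * Cᴴ = 1 := by
    rw [← conjTranspose_mul, mul_nonsing_inv C hCu, conjTranspose_one]
  have hCC' : Cᴴ * C⁻¹ᴴ = 1 := by
    rw [← conjTranspose_mul, nonsing_inv_mul C hCu, conjTranspose_one]
  have hfac : A + B = Cᴴ * (1 + C⁻¹ᴴ * B * C⁻¹) * C := by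
    have : Cᴴ * (C⁻¹ᴴ * B * C⁻¹) * C = (Cᴴ * C⁻¹ᴴ) * B * (C⁻¹ * C) := by
      simp only [Matrix.mul_assoc]
    rw [mul_add, add_mul, mul_one, ← hC, this, hCC', nonsing_inv_mul C hCu, one_mul, mul_one]
  have hdet : (A + B).det = A.det * (1 + C⁻¹ᴴ * B * C⁻¹).det := by
    rw [hfac, det_mul, det_mul, det_conjTranspose, hdetA]
    ring
  have him : A.det.im = 0 := (Complex.pos_iff.mp hA.det_pos).2.symm
  rw [hdet, Complex.mul_re, him, zero_mul, sub_zero]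
  exact le_mul_of_one_le_right hA.det_re_pos.le
    (hB.conjTranspose_mul_mul_same C⁻¹).one_le_det_one_add_re

/-- Rank-many factors are affected by scaling a positive semidefinite perturbation of `1`. -/
lemma PosSemidef.prod_le_pow_rank (hP : P.PosSemidef) {f g : ℝ → ℝ} {c : ℝ} {r : ℕ}
    (hc : 1 ≤ c) (hr : P.rank ≤ r) (hf : ∀ x, 0 ≤ x → 0 ≤ f x) (hg : ∀ x, 0 ≤ x → 0 ≤ g x)
    (h0 : f 0 ≤ g 0) (hfg : ∀ i, f (hP.1.eigenvalues i) ≤ g (hP.1.eigenvalues i) * c) :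
    ∏ i, f (hP.1.eigenvalues i) ≤ (∏ i, g (hP.1.eigenvalues i)) * c ^ r := by
  have hnn := hP.eigenvalues_nonneg
  calc ∏ i, f (hP.1.eigenvalues i)
      ≤ ∏ i, (g (hP.1.eigenvalues i) * if hP.1.eigenvalues i ≠ 0 then c else 1) := by
        refine Finset.prod_le_prod (fun i _ => hf _ (hnn i)) fun i _ => ?_
        split_ifs with h
        · exact hfg i
        · rw [not_not.mp h, mul_one]
          exact h0
    _ = (∏ i, g (hP.1.eigenvalues i)) * c ^ P.rank := by
        rw [Finset.prod_mul_distrib, hP.1.rank_eq_card_non_zero_eigs, Finset.prod_ite,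
          Finset.prod_const_one, mul_one, Finset.prod_const, Fintype.card_subtype]
    _ ≤ (∏ i, g (hP.1.eigenvalues i)) * c ^ r :=
        mul_le_mul_of_nonneg_left (pow_le_pow_right₀ hc hr)
          (Finset.prod_nonneg fun i _ => hg _ (hnn i))

lemma PosSemidef.eigenvalues_le_one (hP : P.PosSemidef) (hP1 : (1 - P).PosSemidef) (i : n) :
    hP.1.eigenvalues i ≤ 1 := by
  have h := hP1.re_dotProduct_nonneg (hP.1.eigenvectorBasis i)
  have h1 : RCLike.re (star (hP.1.eigenvectorBasis i).ofLp ⬝ᵥ (hP.1.eigenvectorBasis i).ofLp)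
      = 1 := by
    rw [dotProduct_comm, ← EuclideanSpace.inner_eq_star_dotProduct]
    simp [inner_self_eq_norm_sq_to_K, hP.1.eigenvectorBasis.orthonormal.1 i]
  rw [sub_mulVec, one_mulVec, dotProduct_sub, map_sub, h1, ← hP.1.eigenvalues_eq i] at h
  linarith

end Matrix

section LogDet

variable {n : ℕ} {P Q : Matrix (Fin n) (Fin n) ℂ}

lemma logdet_one_add_le (hP : P.PosSemidef) (hPQ : (Q - P).PosSemidef) :
    logdet (1 + P) ≤ logdet (1 + Q) := by
  have h1 : (1 + P).PosDef := PosDef.one.add_posSemidef hP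
  have := h1.det_re_le_det_add_re hPQ
  rw [show 1 + P + (Q - P) = 1 + Q by abel] at this
  exact Real.logb_le_logb_of_le one_lt_two h1.det_re_pos this

lemma logdet_one_add_sub_le {M : ℝ} {r : ℕ} (hP : P.PosSemidef) (hM : 1 ≤ M) (hr : P.rank ≤ r) :
    logdet (1 + P) - r * Real.logb 2 M ≤ logdet (1 + ((M⁻¹ : ℝ) : ℂ) • P) := by
  have hM0 : 0 < M := by linarith
  have h1 := hP.1.det_one_add_smul_s18 1
  rw [Complex.ofReal_one, one_smul] at h1
  have hle := hP.prod_le_pow_rank (f := fun x => 1 + 1 * x) (g := fun x => 1 + M⁻¹ * x) hM hr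
    (fun x hx => by positivity) (fun x hx => by positivity) (by simp) fun i => by
      have : (1 + M⁻¹ * hP.1.eigenvalues i) * M = M + hP.1.eigenvalues i := by field_simp
      linarith
  have hpos : 0 < ∏ i, (1 + M⁻¹ * hP.1.eigenvalues i) := Finset.prod_pos fun i _ => by
    have := hP.eigenvalues_nonneg i
    positivity
  have hpos' : 0 < ∏ i, (1 + 1 * hP.1.eigenvalues i) := Finset.prod_pos fun i _ => by
    have := hP.eigenvalues_nonneg i
    positivity
  rw [logdet, logdet, h1, hP.1.det_one_add_smul_s18, Complex.ofReal_re, Complex.ofReal_re,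
    sub_le_iff_le_add, ← Real.logb_pow, ← Real.logb_mul hpos.ne' (by positivity)]
  exact Real.logb_le_logb_of_le one_lt_two hpos' hle

lemma logdet_one_add_smul_le {c : ℝ} {r : ℕ} (hP : P.PosSemidef) (hP1 : (1 - P).PosSemidef)
    (hc : 0 ≤ c) (hr : P.rank ≤ r) :
    logdet (1 + (c : ℂ) • P) ≤ r * Real.logb 2 (1 + c) := by
  have hle := hP.prod_le_pow_rank (f := fun x => 1 + c * x) (g := fun _ => 1) (c := 1 + c)
    (by linarith) hr (fun x hx => by positivity) (fun x hx => by positivity) (by simp) fun i => by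
      nlinarith [hP.eigenvalues_le_one hP1 i]
  rw [Finset.prod_const_one, one_mul] at hle
  have hpos : 0 < ∏ i, (1 + c * hP.1.eigenvalues i) := Finset.prod_pos fun i _ => by
    have := hP.eigenvalues_nonneg i
    positivity
  rw [logdet, hP.1.det_one_add_smul_s18, Complex.ofReal_re, ← Real.logb_pow]
  exact Real.logb_le_logb_of_le one_lt_two hpos hle

end LogDet

lemma Matrix.PosSemidef.real_smul {m : Type*} [Fintype m] {A : Matrix m m ℂ} (hA : A.PosSemidef)
    {c : ℝ} (hc : 0 ≤ c) : ((c : ℂ) • A).PosSemidef :=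
  hA.smul (Complex.zero_le_real.mpr hc)

section Covariance

variable {m n : ℕ} (H : Matrix (Fin n) (Fin m) ℂ) {ρ : ℝ}

lemma posDef_one_add_gram (hρ : 0 ≤ ρ) : (1 + (ρ : ℂ) • (Hᴴ * H)).PosDef :=
  PosDef.one.add_posSemidef ((posSemidef_conjTranspose_mul_self H).real_smul hρ)

lemma KK_posSemidef (hρ : 0 ≤ ρ) : (KK H ρ).PosSemidef :=
  (posDef_one_add_gram H hρ).inv.posSemidef

lemma one_sub_KK_posSemidef (hρ : 0 ≤ ρ) : (1 - KK H ρ).PosSemidef := by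
  have hS := (posSemidef_conjTranspose_mul_self H).real_smul hρ
  have hu := (isUnit_iff_isUnit_det _).mp (posDef_one_add_gram H hρ).isUnit
  set S := (ρ : ℂ) • (Hᴴ * H) with hSdef
  have hK : KK H ρ = (1 + S)⁻¹ := rfl
  have h1 : KK H ρ * (1 + S) = 1 := by rw [hK, nonsing_inv_mul _ hu]
  have h2 : (1 + S) * KK H ρ = 1 := by rw [hK, mul_nonsing_inv _ hu]
  have hH : (KK H ρ)ᴴ = KK H ρ := (KK_posSemidef H hρ).1
  have key : 1 - KK H ρ = (KK H ρ)ᴴ * (S + S ^ 2) * KK H ρ := by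
    have : S + S ^ 2 = (1 + S) * (1 + S) - (1 + S) := by noncomm_ring
    rw [hH, this, mul_sub, sub_mul, ← mul_assoc, h1, one_mul, h2, one_mul]
  rw [key]
  exact (hS.add (hS.pow 2)).conjTranspose_mul_mul_same _

lemma one_sub_smul_mul_KK_mul_posSemidef (hρ : 0 ≤ ρ) :
    (1 - (ρ : ℂ) • (H * KK H ρ * Hᴴ)).PosSemidef := by
  have hu := (isUnit_iff_isUnit_det _).mp (posDef_one_add_gram H hρ).isUnit
  have h2 : (1 + (ρ : ℂ) • (Hᴴ * H)) * KK H ρ = 1 := mul_nonsing_inv _ hu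
  have hpos : (1 + (ρ : ℂ) • (H * Hᴴ)).PosDef := by
    simpa using posDef_one_add_gram Hᴴ hρ
  have key : (1 + (ρ : ℂ) • (H * Hᴴ)) * (1 - (ρ : ℂ) • (H * KK H ρ * Hᴴ)) = 1 := by
    have h3 : (1 + (ρ : ℂ) • (H * Hᴴ)) * (H * KK H ρ * Hᴴ) = H * Hᴴ := by
      calc (1 + (ρ : ℂ) • (H * Hᴴ)) * (H * KK H ρ * Hᴴ)
          = H * ((1 + (ρ : ℂ) • (Hᴴ * H)) * KK H ρ) * Hᴴ := by
            simp only [Matrix.add_mul, Matrix.mul_add, Matrix.one_mul, Matrix.smul_mul,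
              Matrix.mul_smul, Matrix.mul_assoc]
        _ = H * Hᴴ := by rw [h2, Matrix.mul_one]
    rw [mul_sub, mul_one, Matrix.mul_smul, h3, add_sub_cancel_right]
  rw [← inv_eq_right_inv key]
  exact hpos.inv.posSemidef

lemma smul_Ku (c : ℝ) : (c : ℂ) • Ku H ρ = ((c / m : ℝ) : ℂ) • KK H ρ := by
  rw [Ku, smul_smul, Complex.ofReal_div, Complex.ofReal_natCast, div_eq_mul_inv]

lemma smul_mul_Ku_mul {l : ℕ} (G : Matrix (Fin l) (Fin m) ℂ) (c : ℝ) :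
    (c : ℂ) • (G * Ku H ρ * Gᴴ) = G * (((c / m : ℝ) : ℂ) • KK H ρ) * Gᴴ := by
  rw [← smul_Ku, Matrix.mul_smul, Matrix.smul_mul]

/-- The noise term costs at most `min(m, n) log ((m + 1) / m)`. -/
lemma tauI_le (hm : 0 < m) (hρ : 0 ≤ ρ) :
    tauI H ρ ≤ (min m n : ℝ) * Real.logb 2 (((m : ℝ) + 1) / m) := by
  have hm' : (0 : ℝ) < m := by exact_mod_cast hm
  have hP : ((ρ : ℂ) • (H * KK H ρ * Hᴴ)).PosSemidef :=
    ((KK_posSemidef H hρ).mul_mul_conjTranspose_same H).real_smul hρ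
  have hr : ((ρ : ℂ) • (H * KK H ρ * Hᴴ)).rank ≤ min m n := by
    have := rank_mul_mul_add_mul_mul_le H ((ρ : ℂ) • KK H ρ) (0 : Matrix (Fin n) (Fin 0) ℂ) 0
    simpa [Matrix.mul_smul, Matrix.smul_mul, min_comm] using this
  have := logdet_one_add_smul_le (c := (m : ℝ)⁻¹) hP (one_sub_smul_mul_KK_mul_posSemidef H hρ)
    (by positivity) hr
  rw [Nat.cast_min] at this
  convert this using 2
  · rw [tauI, Ku, Matrix.mul_smul, Matrix.smul_mul, smul_comm]
    simp
  · congr 1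
    field_simp

end Covariance

section Receiver

variable {md mc n nx : ℕ} (Hd : Matrix (Fin n) (Fin md) ℂ) (Hc : Matrix (Fin n) (Fin mc) ℂ)
  (Hx : Matrix (Fin nx) (Fin md) ℂ) {ρd ρx ρc : ℝ}

/-- Replacing the input covariances `X, Y` by `X', Y'` which dominate them up to the factor
`max md mc`, and also dominate the noise covariance, costs at most `n1s`. -/
lemma max_logdet_sub_n1s_le (hmd : 0 < md) (hmc : 0 < mc) (hρc : 0 ≤ ρc)
    {X X' : Matrix (Fin md) (Fin md) ℂ} {Y Y' : Matrix (Fin mc) (Fin mc) ℂ}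
    (hX : X.PosSemidef) (hY : Y.PosSemidef) (hX' : X'.PosSemidef)
    (hXX' : (X' - (((max md mc : ℝ)⁻¹ : ℝ) : ℂ) • X).PosSemidef)
    (hYY' : (Y' - (((max md mc : ℝ)⁻¹ : ℝ) : ℂ) • Y).PosSemidef)
    (hY' : (Y' - ((ρc / mc : ℝ) : ℂ) • KK Hc ρc).PosSemidef) :
    max (logdet (1 + (Hd * X * Hdᴴ + Hc * Y * Hcᴴ)) - n1s md mc n) 0
      ≤ logdet (1 + (Hd * X' * Hdᴴ + Hc * Y' * Hcᴴ)) - tauI Hc ρc := by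
  have hmd' : (1 : ℝ) ≤ md := by exact_mod_cast hmd
  have hM : (1 : ℝ) ≤ max (md : ℝ) mc := le_max_of_le_left hmd'
  have hP := (hX.mul_mul_conjTranspose_same Hd).add (hY.mul_mul_conjTranspose_same Hc)
  refine max_le ?_ ?_
  · have hscale := logdet_one_add_sub_le hP hM (rank_mul_mul_add_mul_mul_le Hd X Hc Y)
    have hmono : logdet (1 + (((max md mc : ℝ)⁻¹ : ℝ) : ℂ) • (Hd * X * Hdᴴ + Hc * Y * Hcᴴ))
        ≤ logdet (1 + (Hd * X' * Hdᴴ + Hc * Y' * Hcᴴ)) := by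
      refine logdet_one_add_le (hP.real_smul (by positivity)) ?_
      convert (hXX'.mul_mul_conjTranspose_same Hd).add (hYY'.mul_mul_conjTranspose_same Hc) using 1
      simp only [Matrix.mul_sub, Matrix.sub_mul, Matrix.mul_smul, Matrix.smul_mul, smul_add]
      abel
    have htau := tauI_le Hc hmc hρc
    rw [Nat.cast_min, Nat.cast_add] at hscale
    rw [n1s]
    linarith
  · rw [sub_nonneg, tauI, smul_mul_Ku_mul]
    refine logdet_one_add_le (((KK_posSemidef Hc hρc).real_smul
      (by positivity)).mul_mul_conjTranspose_same Hc) ?_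
    convert (hX'.mul_mul_conjTranspose_same Hd).add (hY'.mul_mul_conjTranspose_same Hc) using 1
    simp only [Matrix.mul_sub, Matrix.sub_mul]
    abel

lemma posSemidef_smul_sub_inv_smul {k : ℕ} {A : Matrix (Fin k) (Fin k) ℂ} (hA : A.PosSemidef)
    {c a M : ℝ} (hc : 0 ≤ c) (ha : 0 < a) (haM : a ≤ M) :
    (((c / a : ℝ) : ℂ) • A - ((M⁻¹ : ℝ) : ℂ) • ((c : ℂ) • A)).PosSemidef := by
  rw [smul_smul, ← sub_smul, ← Complex.ofReal_mul, ← Complex.ofReal_sub]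
  refine hA.real_smul (sub_nonneg.mpr ?_)
  rw [div_eq_inv_mul]
  exact mul_le_mul_of_nonneg_right (inv_anti₀ ha haM) hc

lemma smul_one_sub_smul_KK_posSemidef {c : ℝ} (hc : 0 ≤ c) (hρc : 0 ≤ ρc) :
    ((c : ℂ) • (1 : Matrix (Fin mc) (Fin mc) ℂ) - (c : ℂ) • KK Hc ρc).PosSemidef := by
  rw [← smul_sub]
  exact (one_sub_KK_posSemidef Hc hρc).real_smul hc

lemma max_sub_n1s_le_Ia (hmd : 0 < md) (hmc : 0 < mc) (hρd : 0 ≤ ρd) (hρx : 0 ≤ ρx)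
    (hρc : 0 ≤ ρc) :
    max (logdet (1 + (ρd : ℂ) • (Hd * KK Hx ρx * Hdᴴ)) - n1s md mc n) 0
      ≤ Ia Hd Hc Hx ρd ρx ρc := by
  have hmd' : (0 : ℝ) < md := by exact_mod_cast hmd
  have hK := KK_posSemidef Hx hρx
  have := max_logdet_sub_n1s_le Hd Hc hmd hmc hρc (hK.real_smul hρd) PosSemidef.zero
    (hK.real_smul (c := ρd / md) (by positivity))
    (posSemidef_smul_sub_inv_smul hK hρd hmd' (le_max_left _ _))
    (Y' := ((ρc / mc : ℝ) : ℂ) • KK Hc ρc)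
    (by simpa using (KK_posSemidef Hc hρc).real_smul (c := ρc / mc) (by positivity))
    (by simpa using PosSemidef.zero)
  rw [Ia, smul_mul_Ku_mul, smul_mul_Ku_mul, add_assoc]
  simpa only [Matrix.mul_smul, Matrix.smul_mul, Matrix.mul_zero, Matrix.zero_mul, add_zero]
    using this

lemma max_sub_n1s_le_Id' (hmd : 0 < md) (hmc : 0 < mc) (hρd : 0 ≤ ρd) (hρc : 0 ≤ ρc) :
    max (logdet (1 + (ρd : ℂ) • (Hd * Hdᴴ)) - n1s md mc n) 0 ≤ Id' Hd Hc ρd ρc := by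
  have hmd' : (0 : ℝ) < md := by exact_mod_cast hmd
  have := max_logdet_sub_n1s_le Hd Hc hmd hmc hρc (PosSemidef.one.real_smul hρd) PosSemidef.zero
    (PosSemidef.one.real_smul (c := ρd / md) (by positivity))
    (posSemidef_smul_sub_inv_smul PosSemidef.one hρd hmd' (le_max_left _ _))
    (Y' := ((ρc / mc : ℝ) : ℂ) • KK Hc ρc)
    (by simpa using (KK_posSemidef Hc hρc).real_smul (c := ρc / mc) (by positivity))
    (by simpa using PosSemidef.zero)
  rw [Id', smul_mul_Ku_mul, add_assoc]
  simpa only [Matrix.mul_smul, Matrix.smul_mul, Matrix.mul_zero, Matrix.zero_mul, add_zero,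
    Matrix.mul_one] using this

lemma max_sub_n1s_le_Ie (hmd : 0 < md) (hmc : 0 < mc) (hρd : 0 ≤ ρd) (hρx : 0 ≤ ρx)
    (hρc : 0 ≤ ρc) :
    max (logdet (1 + (ρc : ℂ) • (Hc * Hcᴴ) + (ρd : ℂ) • (Hd * KK Hx ρx * Hdᴴ)) - n1s md mc n) 0
      ≤ Ie Hd Hc Hx ρd ρx ρc := by
  have hmd' : (0 : ℝ) < md := by exact_mod_cast hmd
  have hmc' : (0 : ℝ) < mc := by exact_mod_cast hmc
  have hK := KK_posSemidef Hx hρx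
  have := max_logdet_sub_n1s_le Hd Hc hmd hmc hρc (hK.real_smul hρd)
    (PosSemidef.one.real_smul hρc) (hK.real_smul (c := ρd / md) (by positivity))
    (posSemidef_smul_sub_inv_smul hK hρd hmd' (le_max_left _ _))
    (posSemidef_smul_sub_inv_smul PosSemidef.one hρc hmc' (le_max_right _ _))
    (smul_one_sub_smul_KK_posSemidef Hc (by positivity) hρc)
  rw [Ie, smul_mul_Ku_mul, add_assoc, add_assoc, add_comm (_ • (Hc * _)),
    add_comm (_ • (Hc * _))]
  simpa only [Matrix.mul_smul, Matrix.smul_mul, Matrix.mul_one] using this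

lemma max_sub_n1s_le_Ig (hmd : 0 < md) (hmc : 0 < mc) (hρd : 0 ≤ ρd) (hρc : 0 ≤ ρc) :
    max (logdet (1 + (ρc : ℂ) • (Hc * Hcᴴ) + (ρd : ℂ) • (Hd * Hdᴴ)) - n1s md mc n) 0
      ≤ Ig Hd Hc ρd ρc := by
  have hmd' : (0 : ℝ) < md := by exact_mod_cast hmd
  have hmc' : (0 : ℝ) < mc := by exact_mod_cast hmc
  have := max_logdet_sub_n1s_le Hd Hc hmd hmc hρc (PosSemidef.one.real_smul hρd)
    (PosSemidef.one.real_smul hρc) (PosSemidef.one.real_smul (c := ρd / md) (by positivity))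
    (posSemidef_smul_sub_inv_smul PosSemidef.one hρd hmd' (le_max_left _ _))
    (posSemidef_smul_sub_inv_smul PosSemidef.one hρc hmc' (le_max_right _ _))
    (smul_one_sub_smul_KK_posSemidef Hc (by positivity) hρc)
  rw [Ig, add_assoc, add_assoc, add_comm (_ • (Hc * _)), add_comm (_ • (Hc * _))]
  simpa only [Matrix.mul_smul, Matrix.smul_mul, Matrix.mul_one] using this

end Receiver

lemma n2s_eq_n1s (M1 M2 N2 : ℕ) : n2s M1 M2 N2 = n1s M2 M1 N2 := by
  rw [n2s, n1s, add_comm (M1 : ℝ), max_comm]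

/-- Lemma 7 of the paper. Every rate pair of `R_a*` satisfies the
seven inequalities of the region `R_2`. -/
theorem stmt_18 (M1 N1 M2 N2 : ℕ) (hM1 : 0 < M1) (hN1 : 0 < N1) (hM2 : 0 < M2) (hN2 : 0 < N2)
    (H11 : Matrix (Fin N1) (Fin M1) ℂ) (H12 : Matrix (Fin N2) (Fin M1) ℂ)
    (H21 : Matrix (Fin N1) (Fin M2) ℂ) (H22 : Matrix (Fin N2) (Fin M2) ℂ)
    (ρ11 ρ12 ρ21 ρ22 : ℝ) (h11 : 0 ≤ ρ11) (h12 : 0 ≤ ρ12) (h21 : 0 ≤ ρ21) (h22 : 0 ≤ ρ22)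
    (R1 R2 : ℝ) (hmem : (R1, R2) ∈ Rastar H11 H12 H21 H22 ρ11 ρ12 ρ21 ρ22) :
    R1 ≤ Id' H11 H21 ρ11 ρ21 ∧
    R2 ≤ Id' H22 H12 ρ22 ρ12 ∧
    R1 + R2 ≤ Ig H22 H12 ρ22 ρ12 + Ia H11 H21 H12 ρ11 ρ12 ρ21 ∧
    R1 + R2 ≤ Ig H11 H21 ρ11 ρ21 + Ia H22 H12 H21 ρ22 ρ21 ρ12 ∧
    R1 + R2 ≤ Ie H11 H21 H12 ρ11 ρ12 ρ21 + Ie H22 H12 H21 ρ22 ρ21 ρ12 ∧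
    2 * R1 + R2 ≤ Ig H11 H21 ρ11 ρ21 + Ia H11 H21 H12 ρ11 ρ12 ρ21
        + Ie H22 H12 H21 ρ22 ρ21 ρ12 ∧
    R1 + 2 * R2 ≤ Ig H22 H12 ρ22 ρ12 + Ia H22 H12 H21 ρ22 ρ21 ρ12
        + Ie H11 H21 H12 ρ11 ρ12 ρ21 := by
  obtain ⟨-, -, hR1, hR2, hs1, hs2, hs3, ht1, ht2⟩ := hmem
  rw [n2s_eq_n1s] at *
  simp only at *
  have a1 := max_le_iff.mp (max_sub_n1s_le_Ia H11 H21 H12 hM1 hM2 h11 h12 h21)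
  have d1 := max_sub_n1s_le_Id' H11 H21 hM1 hM2 h11 h21
  have e1 := max_le_iff.mp (max_sub_n1s_le_Ie H11 H21 H12 hM1 hM2 h11 h12 h21)
  have g1 := max_le_iff.mp (max_sub_n1s_le_Ig H11 H21 hM1 hM2 h11 h21)
  have a2 := max_le_iff.mp (max_sub_n1s_le_Ia H22 H12 H21 hM2 hM1 h22 h21 h12)
  have d2 := max_sub_n1s_le_Id' H22 H12 hM2 hM1 h22 h12
  have e2 := max_le_iff.mp (max_sub_n1s_le_Ie H22 H12 H21 hM2 hM1 h22 h21 h12)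
  have g2 := max_le_iff.mp (max_sub_n1s_le_Ig H22 H12 hM2 hM1 h22 h12)
  refine ⟨hR1.trans d1, hR2.trans d2, hs1.trans (max_le ?_ ?_), hs2.trans (max_le ?_ ?_),
    hs3.trans (max_le ?_ ?_), ht1.trans (max_le ?_ ?_), ht2.trans (max_le ?_ ?_)⟩ <;>
  linarith [a1.1, a1.2, e1.1, e1.2, g1.1, g1.2, a2.1, a2.2, e2.1, e2.2, g2.1, g2.2]
end
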